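/- arXiv:2501.04165 — 15 statements merged into one kernel-verified Lean document; each statement's English description precedes it below -/
import Mathlib

section
/- For every integer j ≥ 1, A_j ≥ max{ j²/(4L), (1/L)·(1 + √μ/(2√L))^{2(j−1)} }. -/
/-- One step `A ↦ A + a` increases `√A` by at least `√τ / 2`. -/
theorem sq_sqrt_add_half_sqrt_le {A τ : ℝ} (hA : 0 ≤ A) (hτ : 0 ≤ τ) :
    (√A + √τ / 2) ^ 2 ≤ A + (τ + √(τ ^ 2 + 4 * τ * A)) / 2 := by
  have h : 2 * (√A * √τ) ≤ √(τ ^ 2 + 4 * τ * A) := by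
    apply Real.le_sqrt_of_sq_le
    rw [mul_pow, mul_pow, Real.sq_sqrt hA, Real.sq_sqrt hτ]
    nlinarith [sq_nonneg τ]
  nlinarith [Real.sq_sqrt hA, Real.sq_sqrt hτ]


/-- For every integer j ≥ 1, A_j ≥ max{ j²/(4L), (1/L)(1 + √μ/(2√L))^{2(j−1)} }. -/
theorem A_growth (L μ : ℝ) (hL : 0 < L) (hμ : 0 ≤ μ)
    (τ a A : ℕ → ℝ)
    (hτ0 : τ 0 = 1 / L) (hA0 : A 0 = 0)
    (ha : ∀ j : ℕ, a j = (τ j + Real.sqrt ((τ j) ^ 2 + 4 * τ j * A j)) / 2)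
    (hA : ∀ j : ℕ, A (j + 1) = A j + a j)
    (hτ : ∀ j : ℕ, τ (j + 1) = τ j + μ * a j / L) :
    ∀ j : ℕ, 1 ≤ j →
      A j ≥ max ((j : ℝ) ^ 2 / (4 * L))
        ((1 / L) * (1 + Real.sqrt μ / (2 * Real.sqrt L)) ^ (2 * (j - 1))) := by
  have hτA (j : ℕ) : τ j = (1 + μ * A j) / L := by
    induction j with
    | zero => simp [hτ0, hA0]
    | succ k ih => rw [hτ, hA, ih]; ring
  have hτ_nonneg {j : ℕ} (h : 0 ≤ A j) : 0 ≤ τ j := by rw [hτA]; positivity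
  have hA_nonneg (j : ℕ) : 0 ≤ A j := by
    induction j with
    | zero => exact hA0.ge
    | succ k ih =>
      have := hτ_nonneg ih
      rw [hA, ha]
      positivity
  have hstep (j : ℕ) : (√(A j) + √(τ j) / 2) ^ 2 ≤ A (j + 1) := by
    rw [hA, ha]
    exact sq_sqrt_add_half_sqrt_le (hA_nonneg j) (hτ_nonneg (hA_nonneg j))
  have hlin (j : ℕ) : j * (√(1 / L) / 2) ≤ √(A j) := by
    induction j with
    | zero => simp
    | succ k ih =>
      have h1 : √(1 / L) ≤ √(τ k) := by
        rw [hτA]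
        gcongr
        linarith [mul_nonneg hμ (hA_nonneg k)]
      have h2 := Real.le_sqrt_of_sq_le (hstep k)
      push_cast
      linarith
  have hgeom (j : ℕ) : 1 / L * (1 + √μ / (2 * √L)) ^ (2 * j) ≤ A (j + 1) := by
    induction j with
    | zero =>
      simp [hA, ha, hA0, hτ0, Real.sqrt_sq hL.le]
    | succ k ih =>
      have h : √(A (k + 1)) * (√μ / √L) ≤ √(τ (k + 1)) := by
        rw [← Real.sqrt_div hμ, ← Real.sqrt_mul (hA_nonneg _), hτA]
        apply Real.sqrt_le_sqrt
        rw [mul_div_assoc', mul_comm]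
        gcongr
        linarith
      calc 1 / L * (1 + √μ / (2 * √L)) ^ (2 * (k + 1))
          = 1 / L * (1 + √μ / (2 * √L)) ^ (2 * k) * (1 + √μ / (2 * √L)) ^ 2 := by ring
        _ ≤ A (k + 1) * (1 + √μ / (2 * √L)) ^ 2 := by gcongr
        _ = (√(A (k + 1)) + √(A (k + 1)) * (√μ / √L) / 2) ^ 2 := by
          nth_rw 1 [← Real.sq_sqrt (hA_nonneg (k + 1))]
          ring
        _ ≤ (√(A (k + 1)) + √(τ (k + 1)) / 2) ^ 2 := by gcongr
        _ ≤ A (k + 1 + 1) := hstep _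
  intro j hj
  refine max_le ?_ ?_
  · calc (j : ℝ) ^ 2 / (4 * L) = (j * (√(1 / L) / 2)) ^ 2 := by
          rw [mul_pow, div_pow, Real.sq_sqrt (by positivity)]
          field_simp
          norm_num
      _ ≤ √(A j) ^ 2 := by gcongr; exact hlin j
      _ = A j := Real.sq_sqrt (hA_nonneg j)
  · obtain ⟨k, rfl⟩ := Nat.exists_eq_add_of_le' hj
    exact hgeom k
end

section
/- For every u ∈ E, γ(u) ≤ γ̃(u) ≤ ψ(u), and moreover γ(ỹ) = γ̃(ỹ). -/
open scoped RealInnerProductSpace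

/-- The first-order characterization of convexity: a convex function lies above its tangents. -/
theorem ConvexOn.add_inner_le_of_hasGradientAt {E : Type*} [NormedAddCommGroup E]
    [InnerProductSpace ℝ E] [CompleteSpace E] {f : E → ℝ} (hf : ConvexOn ℝ Set.univ f)
    {v x : E} (hv : HasGradientAt f v x) (u : E) : f x + ⟪v, u - x⟫ ≤ f u := by
  have hconv : ConvexOn ℝ Set.univ (f ∘ AffineMap.lineMap (k := ℝ) x u) := by
    simpa using hf.comp_affineMap (AffineMap.lineMap (k := ℝ) x u)
  have hderiv : HasDerivAt (f ∘ AffineMap.lineMap (k := ℝ) x u) ⟪v, u - x⟫ 0 := by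
    have hline : HasDerivAt (AffineMap.lineMap (k := ℝ) x u) (u - x) (0 : ℝ) :=
      AffineMap.hasDerivAt_lineMap
    have hv' : HasFDerivAt f (InnerProductSpace.toDual ℝ E v)
        (AffineMap.lineMap (k := ℝ) x u 0) := by
      simpa using hv.hasFDerivAt
    simpa using hv'.comp_hasDerivAt (0 : ℝ) hline
  have hslope := hconv.le_slope_of_hasDerivAt (Set.mem_univ 0) (Set.mem_univ 1) one_pos hderiv
  have hslope' : ⟪v, u - x⟫ ≤ f u - f x := by simpa [slope_def_field] using hslope
  linarith

/-- If `f` is `m`-strongly convex and `y` minimizes `f + (c / 2) ‖· - x‖²`, then `f` lies above the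
quadratic of curvature `m` that touches it at `y` with slope `c • (x - y)`. -/
theorem StrongConvexOn.add_inner_le_of_forall_prox_le {E : Type*} [NormedAddCommGroup E]
    [InnerProductSpace ℝ E] {f : E → ℝ} {m : ℝ} (hf : StrongConvexOn Set.univ m f) {c : ℝ} {x y : E}
    (hy : ∀ u, f y + c / 2 * ‖y - x‖ ^ 2 ≤ f u + c / 2 * ‖u - x‖ ^ 2) (u : E) :
    f y + c * ⟪x - y, u - y⟫ + m / 2 * ‖u - y‖ ^ 2 ≤ f u := by
  have key : ∀ t ∈ Set.Ioo (0 : ℝ) 1,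
      f y + c * ⟪x - y, u - y⟫ + m / 2 * ‖u - y‖ ^ 2 ≤ f u + t * ((c + m) / 2 * ‖u - y‖ ^ 2) := by
    rintro t ⟨ht0, ht1⟩
    have hconv := hf.2 (Set.mem_univ y) (Set.mem_univ u) (sub_nonneg.2 ht1.le) ht0.le
      (sub_add_cancel 1 t)
    have hmin := hy ((1 - t) • y + t • u)
    have hnorm : ‖(1 - t) • y + t • u - x‖ ^ 2 =
        ‖y - x‖ ^ 2 - 2 * t * ⟪x - y, u - y⟫ + t ^ 2 * ‖u - y‖ ^ 2 := by
      rw [show (1 - t) • y + t • u - x = t • (u - y) - (x - y) by module, norm_sub_sq_real,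
        real_inner_smul_left, norm_smul, mul_pow, Real.norm_eq_abs, sq_abs, norm_sub_rev x y,
        real_inner_comm]
      ring
    rw [hnorm] at hmin
    simp only [smul_eq_mul, norm_sub_rev y u] at hconv
    refine le_of_mul_le_mul_left ?_ ht0
    linear_combination hmin + hconv
  have hlim : Filter.Tendsto (fun t : ℝ => f u + t * ((c + m) / 2 * ‖u - y‖ ^ 2))
      (nhdsWithin 0 (Set.Ioi 0)) (nhds (f u)) := by
    have hcont : Continuous (fun t : ℝ => f u + t * ((c + m) / 2 * ‖u - y‖ ^ 2)) := by fun_prop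
    simpa using (hcont.tendsto 0).mono_left nhdsWithin_le_nhds
  exact ge_of_tendsto hlim (Filter.mem_of_superset (Ioo_mem_nhdsGT one_pos) key)

/-- Lemma 2.2(a), inequalities: γ ≤ γ̃ ≤ ψ = g + h, and γ(ỹ) = γ̃(ỹ). -/
theorem gamma_le (μ L : ℝ) (hμ : 0 ≤ μ) (hL : 0 < L)
    {E : Type*} [NormedAddCommGroup E] [InnerProductSpace ℝ E] [FiniteDimensional ℝ E]
    (g : E → ℝ) (g' : E → E) (hg : ∀ x, HasGradientAt g (g' x) x)
    (hgsc : ConvexOn ℝ Set.univ (fun u => g u - μ / 2 * ‖u‖ ^ 2))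
    (h : E → ℝ) (hh : ConvexOn ℝ Set.univ h)
    (xt yt : E) (γt γ : E → ℝ)
    (hγt : ∀ u, γt u = g xt + ⟪g' xt, u - xt⟫ + h u + μ / 2 * ‖u - xt‖ ^ 2)
    (hyt : ∀ u, γt yt + L / 2 * ‖yt - xt‖ ^ 2 ≤ γt u + L / 2 * ‖u - xt‖ ^ 2)
    (hγ : ∀ u, γ u = γt yt + L * ⟪xt - yt, u - yt⟫ + μ / 2 * ‖u - yt‖ ^ 2) :
    (∀ u, γ u ≤ γt u ∧ γt u ≤ g u + h u) ∧ γ yt = γt yt := by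
  have hsq : ∀ a b : E, ‖a - b‖ ^ 2 = ‖a‖ ^ 2 - 2 * ⟪b, a - b⟫ - ‖b‖ ^ 2 := by
    intro a b
    rw [norm_sub_sq_real, inner_sub_right, real_inner_self_eq_norm_sq, real_inner_comm]
    ring
  refine ⟨fun u => ⟨?_, ?_⟩, by simp [hγ]⟩
  · have hγt_convex : StrongConvexOn Set.univ μ γt := by
      rw [strongConvexOn_iff_convex]
      have haff : ConvexOn ℝ Set.univ
          (fun w => ⟪g' xt - μ • xt, w⟫ + (g xt - ⟪g' xt, xt⟫ + μ / 2 * ‖xt‖ ^ 2)) :=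
        ((innerₛₗ ℝ (g' xt - μ • xt)).convexOn convex_univ).add_const _
      refine (hh.add haff).congr fun w _ => ?_
      simp only [Pi.add_apply, hγt, norm_sub_sq_real, inner_sub_left, inner_sub_right,
        real_inner_smul_left, real_inner_comm w]
      ring
    rw [hγ]
    exact hγt_convex.add_inner_le_of_forall_prox_le hyt u
  · have hgrad : HasGradientAt (fun w => g w - μ / 2 * ‖w‖ ^ 2) (g' xt - μ • xt) xt := by
      rw [hasGradientAt_iff_hasFDerivAt]
      refine ((hg xt).hasFDerivAt.sub
        (((hasStrictFDerivAt_norm_sq xt).hasFDerivAt).const_mul (μ / 2))).congr_fderiv ?_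
      ext w
      simp
      ring
    have hle := hgsc.add_inner_le_of_hasGradientAt hgrad u
    rw [inner_sub_left, real_inner_smul_left] at hle
    rw [hγt, hsq]
    linarith
end

section
/- The minimum over u ∈ E of γ̃(u) + (L/2)‖u − x̃‖² equals the minimum over u ∈ E of γ(u) + (L/2)‖u − x̃‖², and ỹ is the unique minimizer of both of these minimization problems. -/
open scoped RealInnerProductSpace

theorem norm_sub_sq_expand_at {E : Type*} [NormedAddCommGroup E] [InnerProductSpace ℝ E]
    (u x y : E) :
    ‖u - x‖ ^ 2 = ‖u - y‖ ^ 2 - 2 * ⟪x - y, u - y⟫ + ‖y - x‖ ^ 2 := by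
  rw [← sub_sub_sub_cancel_right u x y, norm_sub_sq_real, real_inner_comm, norm_sub_rev x y]

/-- Lemma 2.2(a), equation (2.8): the minimum of γ̃ + (L/2)‖· − x̃‖² equals the minimum of
γ + (L/2)‖· − x̃‖², and ỹ is the unique minimizer of both problems. -/
theorem min_eq_min (μ L : ℝ) (hμ : 0 ≤ μ) (hL : 0 < L)
    {E : Type*} [NormedAddCommGroup E] [InnerProductSpace ℝ E] [FiniteDimensional ℝ E]
    (g : E → ℝ) (g' : E → E) (hg : ∀ x, HasGradientAt g (g' x) x)
    (hgsc : ConvexOn ℝ Set.univ (fun u => g u - μ / 2 * ‖u‖ ^ 2))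
    (h : E → ℝ) (hh : ConvexOn ℝ Set.univ h)
    (xt yt : E) (γt γ : E → ℝ)
    (hγt : ∀ u, γt u = g xt + ⟪g' xt, u - xt⟫ + h u + μ / 2 * ‖u - xt‖ ^ 2)
    (hyt : ∀ u, γt yt + L / 2 * ‖yt - xt‖ ^ 2 ≤ γt u + L / 2 * ‖u - xt‖ ^ 2)
    (hγ : ∀ u, γ u = γt yt + L * ⟪xt - yt, u - yt⟫ + μ / 2 * ‖u - yt‖ ^ 2) :
    (γ yt + L / 2 * ‖yt - xt‖ ^ 2 = γt yt + L / 2 * ‖yt - xt‖ ^ 2)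
    ∧ (∀ u, γ yt + L / 2 * ‖yt - xt‖ ^ 2 ≤ γ u + L / 2 * ‖u - xt‖ ^ 2)
    ∧ (∀ u, γt u + L / 2 * ‖u - xt‖ ^ 2 = γt yt + L / 2 * ‖yt - xt‖ ^ 2 → u = yt)
    ∧ (∀ u, γ u + L / 2 * ‖u - xt‖ ^ 2 = γ yt + L / 2 * ‖yt - xt‖ ^ 2 → u = yt) := by
  have γ_add_eq : ∀ u, γ u + L / 2 * ‖u - xt‖ ^ 2 =
      γt yt + L / 2 * ‖yt - xt‖ ^ 2 + (μ + L) / 2 * ‖u - yt‖ ^ 2 := fun u => by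
    rw [hγ, norm_sub_sq_expand_at u xt yt]
    ring
  have γ_min_eq : γ yt + L / 2 * ‖yt - xt‖ ^ 2 = γt yt + L / 2 * ‖yt - xt‖ ^ 2 := by
    simp [γ_add_eq]
  have eq_of_sq_nonpos : ∀ u, (μ + L) * ‖u - yt‖ ^ 2 ≤ 0 → u = yt := fun u hu => by
    have hsq : ‖u - yt‖ ^ 2 ≤ 0 := nonpos_of_mul_nonpos_right hu (by positivity)
    exact sub_eq_zero.mp (norm_eq_zero.mp (pow_eq_zero_iff two_ne_zero |>.mp
      (le_antisymm hsq (sq_nonneg _))))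
  refine ⟨γ_min_eq, fun u => ?_, fun u hu => eq_of_sq_nonpos u ?_,
    fun u hu => eq_of_sq_nonpos u ?_⟩
  · rw [γ_min_eq, γ_add_eq]
    exact le_add_of_nonneg_right (by positivity)
  · have hmid := hyt ((1 / 2 : ℝ) • u + (1 / 2 : ℝ) • yt)
    have hconv := hh.2 (Set.mem_univ u) (Set.mem_univ yt)
      (by norm_num : (0 : ℝ) ≤ 1 / 2) (by norm_num : (0 : ℝ) ≤ 1 / 2) (by norm_num)
    have hsub : (1 / 2 : ℝ) • u + (1 / 2 : ℝ) • yt - xt =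
        (1 / 2 : ℝ) • ((u - xt) + (yt - xt)) := by
      module
    have hinner : ⟪g' xt, (1 / 2 : ℝ) • ((u - xt) + (yt - xt))⟫ =
        1 / 2 * (⟪g' xt, u - xt⟫ + ⟪g' xt, yt - xt⟫) := by
      rw [real_inner_smul_right, inner_add_right]
    have hnorm : ‖(1 / 2 : ℝ) • ((u - xt) + (yt - xt))‖ ^ 2 =
        1 / 2 * ‖u - xt‖ ^ 2 + 1 / 2 * ‖yt - xt‖ ^ 2 - 1 / 4 * ‖u - yt‖ ^ 2 := by
      rw [norm_smul, mul_pow, norm_add_sq_real, ← sub_sub_sub_cancel_right u yt xt,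
        norm_sub_sq_real (u - xt), Real.norm_of_nonneg (by norm_num)]
      ring
    simp only [hγt, hsub, hinner, hnorm, smul_eq_mul] at hmid hu hconv
    linarith
  · rw [γ_min_eq, γ_add_eq] at hu
    linarith
end

section
/- For every integer j ≥ 0, x_j is the unique minimizer over E of the function u ↦ A_j Γ_j(u) + (1/2)‖u − x_0‖². -/
open scoped RealInnerProductSpace

/-- Adding a quadratic model `γ u = d + L⟪w - v, u - v⟫ + (μ / 2)‖u - v‖²` of weight `b` to a
quadratic with Hessian `K • id` centred at `p` gives a quadratic centred at any point `q` at which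
the total gradient vanishes. -/
lemma add_quadratic_model_eq {E : Type*} [NormedAddCommGroup E] [InnerProductSpace ℝ E]
    (K b L μ : ℝ) (p q v w : E)
    (hq : K • (q - p) + (b * L) • (w - v) + (b * μ) • (q - v) = 0) (u : E) :
    K / 2 * ‖u - p‖ ^ 2 + b * (L * ⟪w - v, u - v⟫ + μ / 2 * ‖u - v‖ ^ 2)
      = (K / 2 * ‖q - p‖ ^ 2 + b * (L * ⟪w - v, q - v⟫ + μ / 2 * ‖q - v‖ ^ 2))
        + (K + b * μ) / 2 * ‖u - q‖ ^ 2 := by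
  have hgrad : K * ⟪q - p, u - q⟫ + b * L * ⟪w - v, u - q⟫ + b * μ * ⟪q - v, u - q⟫ = 0 := by
    simpa [inner_add_left, real_inner_smul_left] using congrArg (fun z => ⟪z, u - q⟫) hq
  have hp : ‖u - p‖ ^ 2 = ‖q - p‖ ^ 2 + 2 * ⟪q - p, u - q⟫ + ‖u - q‖ ^ 2 := by
    rw [← norm_add_sq_real, sub_add_sub_comm, add_comm q u, add_sub_add_right_eq_sub]
  have hv : ‖u - v‖ ^ 2 = ‖q - v‖ ^ 2 + 2 * ⟪q - v, u - q⟫ + ‖u - q‖ ^ 2 := by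
    rw [← norm_add_sq_real, sub_add_sub_comm, add_comm q u, add_sub_add_right_eq_sub]
  have hw : ⟪w - v, u - v⟫ = ⟪w - v, q - v⟫ + ⟪w - v, u - q⟫ := by
    rw [← inner_add_right, add_comm, sub_add_sub_cancel]
  rw [hp, hv, hw]
  linear_combination hgrad

/-- Lemma 2.2(c): x_j is the unique minimizer of u ↦ A_j Γ_j(u) + (1/2)‖u − x_0‖². -/
theorem x_is_unique_min
    (μ L : ℝ) (hμ : 0 ≤ μ) (hL : 0 < L)
    {E : Type*} [NormedAddCommGroup E] [InnerProductSpace ℝ E] [FiniteDimensional ℝ E]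
    (g : E → ℝ) (g' : E → E) (hg : ∀ x, HasGradientAt g (g' x) x)
    (hgsc : ConvexOn ℝ Set.univ (fun u => g u - μ / 2 * ‖u‖ ^ 2))
    (hgsmooth : ∀ x y : E, ‖g' x - g' y‖ ≤ (L + μ) * ‖x - y‖)
    (h : E → ℝ) (hh : ConvexOn ℝ Set.univ h)
    (τ a A : ℕ → ℝ)
    (hτ0 : τ 0 = 1 / L) (hA0 : A 0 = 0)
    (ha : ∀ j : ℕ, a j = (τ j + Real.sqrt ((τ j) ^ 2 + 4 * τ j * A j)) / 2)
    (hA : ∀ j : ℕ, A (j + 1) = A j + a j)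
    (hτ : ∀ j : ℕ, τ (j + 1) = τ j + μ * a j / L)
    (x y xt yt : ℕ → E)
    (hy0 : y 0 = x 0)
    (hxt : ∀ j : ℕ, xt j = (A j / A (j + 1)) • y j + (a j / A (j + 1)) • x j)
    (hyt : ∀ j : ℕ, ∀ u : E,
      g (xt j) + ⟪g' (xt j), yt (j + 1) - xt j⟫ + h (yt (j + 1))
        + (L + μ) / 2 * ‖yt (j + 1) - xt j‖ ^ 2
      ≤ g (xt j) + ⟪g' (xt j), u - xt j⟫ + h u + (L + μ) / 2 * ‖u - xt j‖ ^ 2)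
    (hy : ∀ j : ℕ, (y (j + 1) = y j ∨ y (j + 1) = yt (j + 1))
      ∧ g (y (j + 1)) + h (y (j + 1)) ≤ g (y j) + h (y j)
      ∧ g (y (j + 1)) + h (y (j + 1)) ≤ g (yt (j + 1)) + h (yt (j + 1)))
    (hx : ∀ j : ℕ, x (j + 1) = (A (j + 1) * μ + 1)⁻¹ •
      (((L + μ) * a j) • yt (j + 1) - (A j * a j * L / A (j + 1)) • y j))
    (γt γ Γ : ℕ → E → ℝ)
    (hγt : ∀ (j : ℕ) (u : E),
      γt j u = g (xt j) + ⟪g' (xt j), u - xt j⟫ + h u + μ / 2 * ‖u - xt j‖ ^ 2)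
    (hγ : ∀ (j : ℕ) (u : E),
      γ j u = γt j (yt (j + 1)) + L * ⟪xt j - yt (j + 1), u - yt (j + 1)⟫
        + μ / 2 * ‖u - yt (j + 1)‖ ^ 2)
    (hΓ0 : ∀ u : E, Γ 0 u = 0)
    (hΓ : ∀ (j : ℕ) (u : E), Γ (j + 1) u = (A j * Γ j u + a j * γ j u) / A (j + 1)) :
    ∀ j : ℕ,
      (∀ u : E, A j * Γ j (x j) + 1 / 2 * ‖x j - x 0‖ ^ 2
        ≤ A j * Γ j u + 1 / 2 * ‖u - x 0‖ ^ 2)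
      ∧ (∀ u : E, A j * Γ j u + 1 / 2 * ‖u - x 0‖ ^ 2
          = A j * Γ j (x j) + 1 / 2 * ‖x j - x 0‖ ^ 2 → u = x j) := by
  have hτA : ∀ j, L * τ j = A j * μ + 1 := by
    intro j
    induction j with
    | zero => rw [hτ0, hA0]; field_simp; ring
    | succ j ih =>
      rw [hτ, hA]
      field_simp
      linear_combination ih
  have hpos : ∀ j, 0 ≤ A j ∧ 0 < τ j ∧ 0 < a j := by
    have key : ∀ j, 0 ≤ A j → 0 < τ j ∧ 0 < a j := by
      intro j hj
      have hτj : 0 < τ j := by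
        refine pos_of_mul_pos_right (a := L) ?_ hL.le
        rw [hτA]
        positivity
      exact ⟨hτj, by rw [ha]; positivity⟩
    intro j
    induction j with
    | zero => exact ⟨hA0.ge, key 0 hA0.ge⟩
    | succ j ih =>
      have hj : 0 ≤ A (j + 1) := by rw [hA]; linarith [ih.1, ih.2.2]
      exact ⟨hj, key _ hj⟩
  have hApos : ∀ j, 0 < A (j + 1) := fun j => by rw [hA]; linarith [(hpos j).1, (hpos j).2.2]
  have hsq : ∀ j, a j ^ 2 * L = A (j + 1) * (A j * μ + 1) := by
    intro j
    obtain ⟨hAj, hτj, -⟩ := hpos j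
    have hs : Real.sqrt (τ j ^ 2 + 4 * τ j * A j) ^ 2 = τ j ^ 2 + 4 * τ j * A j :=
      Real.sq_sqrt (by positivity)
    have hroot : Real.sqrt (τ j ^ 2 + 4 * τ j * A j) = 2 * a j - τ j := by rw [ha]; ring
    rw [hroot] at hs
    rw [hA, ← hτA]
    linear_combination L / 4 * hs
  have hform : ∀ j, ∃ c : ℝ, ∀ u : E, A j * Γ j u + 1 / 2 * ‖u - x 0‖ ^ 2
      = c + (A j * μ + 1) / 2 * ‖u - x j‖ ^ 2 := by
    intro j
    induction j with
    | zero => exact ⟨0, fun u => by rw [hA0]; ring⟩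
    | succ j ih =>
      obtain ⟨c, hc⟩ := ih
      have hA' := hApos j
      have hK : 0 < A (j + 1) * μ + 1 := by positivity
      have hxj : (A (j + 1) * μ + 1) • x (j + 1)
          = ((L + μ) * a j) • yt (j + 1) - (A j * a j * L / A (j + 1)) • y j := by
        rw [hx, smul_inv_smul₀ hK.ne']
      have hcoef : a j * L * (a j / A (j + 1)) = A j * μ + 1 := by
        field_simp
        linear_combination hsq j
      have hgrad : (A j * μ + 1) • (x (j + 1) - x j) + (a j * L) • (xt j - yt (j + 1))
          + (a j * μ) • (x (j + 1) - yt (j + 1)) = 0 := by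
        have hsum : A (j + 1) * μ + 1 = A j * μ + 1 + a j * μ := by rw [hA]; ring
        rw [hsum] at hxj
        have hcx := congrArg (fun r : ℝ => r • x j) hcoef
        rw [hxt]
        linear_combination (norm := module) hxj + hcx
      have hquad := add_quadratic_model_eq (A j * μ + 1) (a j) L μ _ _ _ _ hgrad
      refine ⟨c + a j * γt j (yt (j + 1)) + ((A j * μ + 1) / 2 * ‖x (j + 1) - x j‖ ^ 2
        + a j * (L * ⟪xt j - yt (j + 1), x (j + 1) - yt (j + 1)⟫
          + μ / 2 * ‖x (j + 1) - yt (j + 1)‖ ^ 2)), fun u => ?_⟩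
      have hΓu : A (j + 1) * Γ (j + 1) u = A j * Γ j u + a j * γ j u := by
        rw [hΓ]; field_simp
      rw [hΓu, hγ, hA]
      linear_combination hc u + hquad u
  intro j
  obtain ⟨c, hc⟩ := hform j
  have hK : 0 < A j * μ + 1 := by have := (hpos j).1; positivity
  refine ⟨fun u => ?_, fun u hu => ?_⟩
  · rw [hc, hc u, sub_self, norm_zero]
    have : 0 ≤ (A j * μ + 1) / 2 * ‖u - x j‖ ^ 2 := by positivity
    linarith
  · rw [hc, hc (x j), sub_self, norm_zero] at hu
    have hzero : (A j * μ + 1) / 2 * ‖u - x j‖ ^ 2 = 0 := by linarith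
    have hnorm := (mul_eq_zero.mp hzero).resolve_left (by positivity)
    exact sub_eq_zero.mp (norm_eq_zero.mp (pow_eq_zero_iff two_ne_zero |>.mp hnorm))
end

section
/- For every integer j ≥ 0, A_j ψ(y_j) ≤ inf over u ∈ E of A_j Γ_j(u) + (1/2)‖u − x_0‖². -/
open scoped RealInnerProductSpace

section GradientInequalities

variable {E : Type*} [NormedAddCommGroup E] [InnerProductSpace ℝ E] [CompleteSpace E]

theorem HasGradientAt.hasDerivAt_comp_line {f : E → ℝ} {v x d : E} {t : ℝ}
    (hf : HasGradientAt f v (x + t • d)) :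
    HasDerivAt (fun s : ℝ => f (x + s • d)) ⟪v, d⟫ t := by
  have hl : HasDerivAt (fun s : ℝ => x + s • d) d t := by
    simpa using ((hasDerivAt_id t).smul_const d).const_add x
  exact (hf.hasFDerivAt.comp_hasDerivAt t hl).congr_deriv (by simp)

/-- The descent lemma for a function with Lipschitz gradient. -/
theorem le_add_inner_add_sq_of_lipschitz_gradient {f : E → ℝ} {f' : E → E} {K : ℝ}
    (hf : ∀ x, HasGradientAt f (f' x) x) (hK : ∀ x y, ‖f' x - f' y‖ ≤ K * ‖x - y‖) (x u : E) :
    f u ≤ f x + ⟪f' x, u - x⟫ + K / 2 * ‖u - x‖ ^ 2 := by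
  set d := u - x with hd
  have hderiv : ∀ t : ℝ, HasDerivAt
      (fun s : ℝ => f (x + s • d) - s * ⟪f' x, d⟫ - K / 2 * ‖d‖ ^ 2 * s ^ 2)
      (⟪f' (x + t • d), d⟫ - 1 * ⟪f' x, d⟫ - K / 2 * ‖d‖ ^ 2 * (2 * t)) t := fun t => by
    have hsq : HasDerivAt (fun s : ℝ => s ^ 2) (2 * t) t := by
      simpa using hasDerivAt_pow 2 t
    exact ((hf (x + t • d)).hasDerivAt_comp_line.sub
      ((hasDerivAt_id t).mul_const ⟪f' x, d⟫)).sub (hsq.const_mul _)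
  have hanti := antitoneOn_of_hasDerivWithinAt_nonpos (convex_Icc (0 : ℝ) 1)
    (fun t _ => (hderiv t).continuousAt.continuousWithinAt)
    (fun t _ => (hderiv t).hasDerivWithinAt) (fun t ht => by
      have ht0 : 0 ≤ t := (interior_subset ht).1
      have hle : ⟪f' (x + t • d) - f' x, d⟫ ≤ K * (t * ‖d‖) * ‖d‖ := by
        refine (real_inner_le_norm _ _).trans ?_
        have := hK (x + t • d) x
        rw [add_sub_cancel_left, norm_smul, Real.norm_of_nonneg ht0] at this
        gcongr
      rw [inner_sub_left] at hle
      nlinarith)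
  have := hanti (by simp) (by simp) (zero_le_one (α := ℝ))
  simp [hd] at this
  linarith

/-- The first-order lower bound for a convex differentiable function. -/
theorem ConvexOn.add_inner_le {f : E → ℝ} {v x : E} (hf : ConvexOn ℝ Set.univ f)
    (hv : HasGradientAt f v x) (u : E) : f x + ⟪v, u - x⟫ ≤ f u := by
  have hline : ConvexOn ℝ Set.univ (fun s : ℝ => f (x + s • (u - x))) := by
    simpa [Function.comp_def, AffineMap.lineMap_apply, add_comm] using
      hf.comp_affineMap (AffineMap.lineMap x u : ℝ →ᵃ[ℝ] E)
  have hd : HasDerivAt (fun s : ℝ => f (x + s • (u - x))) ⟪v, u - x⟫ 0 :=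
    HasGradientAt.hasDerivAt_comp_line (by simpa using hv)
  have := hline.le_slope_of_hasDerivAt (Set.mem_univ 0) (Set.mem_univ 1) one_pos hd
  simp [slope_def_field] at this
  linarith

/-- The first-order lower bound for a strongly convex differentiable function. -/
theorem ConvexOn.add_inner_add_sq_le {f : E → ℝ} {v x : E} {μ : ℝ}
    (hf : ConvexOn ℝ Set.univ (fun u => f u - μ / 2 * ‖u‖ ^ 2)) (hv : HasGradientAt f v x)
    (u : E) : f x + ⟪v, u - x⟫ + μ / 2 * ‖u - x‖ ^ 2 ≤ f u := by
  have hgrad : HasGradientAt (fun u => f u - μ / 2 * ‖u‖ ^ 2) (v - μ • x) x := by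
    rw [hasGradientAt_iff_hasFDerivAt] at hv ⊢
    refine (hv.sub ((hasStrictFDerivAt_norm_sq x).hasFDerivAt.const_mul (μ / 2))).congr_fderiv ?_
    ext w
    simp
    ring
  have := hf.add_inner_le hgrad u
  have hn := norm_sub_sq_real u x
  simp only [inner_sub_left, inner_sub_right, real_inner_smul_left,
    real_inner_self_eq_norm_sq] at this ⊢
  rw [real_inner_comm] at hn
  rw [hn]
  linarith

end GradientInequalities

section KeyStep

variable {E : Type*} [NormedAddCommGroup E] [InnerProductSpace ℝ E]

/-- Optimality condition of a proximal step: the displacement is a subgradient. -/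
theorem ConvexOn.inner_le_of_prox {h : E → ℝ} (hh : ConvexOn ℝ Set.univ h) {v c p : E} {K : ℝ}
    (hp : ∀ u, ⟪v, p - c⟫ + h p + K / 2 * ‖p - c‖ ^ 2 ≤ ⟪v, u - c⟫ + h u + K / 2 * ‖u - c‖ ^ 2)
    (u : E) : h p + ⟪K • (c - p) - v, u - p⟫ ≤ h u := by
  have key : ∀ t ∈ Set.Ioc (0 : ℝ) 1,
      0 ≤ (h u - h p - ⟪K • (c - p) - v, u - p⟫) + K / 2 * ‖u - p‖ ^ 2 * t := by
    rintro t ⟨ht0, ht1⟩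
    have hconv := hh.2 (Set.mem_univ p) (Set.mem_univ u) (sub_nonneg.2 ht1) ht0.le
      (by ring : 1 - t + t = 1)
    have hmin := hp ((1 - t) • p + t • u)
    have hsplit : (1 - t) • p + t • u - c = (p - c) + t • (u - p) := by module
    rw [hsplit, norm_add_sq_real, norm_smul, inner_add_right, real_inner_smul_right,
      real_inner_smul_right, Real.norm_of_nonneg ht0.le] at hmin
    have hinner : ⟪K • (c - p) - v, u - p⟫ = -(K * ⟪p - c, u - p⟫) - ⟪v, u - p⟫ := by
      rw [inner_sub_left, real_inner_smul_left, ← neg_sub p c, inner_neg_left]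
      ring
    simp only [smul_eq_mul] at hconv
    rw [hinner]
    refine nonneg_of_mul_nonneg_right (a := t) ?_ ht0
    nlinarith
  have hlim : Filter.Tendsto
      (fun t : ℝ => (h u - h p - ⟪K • (c - p) - v, u - p⟫) + K / 2 * ‖u - p‖ ^ 2 * t)
      (nhdsWithin 0 (Set.Ioi 0)) (nhds (h u - h p - ⟪K • (c - p) - v, u - p⟫)) := by
    have : Continuous
      (fun t : ℝ => (h u - h p - ⟪K • (c - p) - v, u - p⟫) + K / 2 * ‖u - p‖ ^ 2 * t) := by
      fun_prop
    simpa using (this.tendsto 0).mono_left nhdsWithin_le_nhds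
  have := ge_of_tendsto hlim (Filter.mem_of_superset (Ioc_mem_nhdsGT one_pos) key)
  linarith

/-- The quadratic estimate behind one step of the accelerated composite gradient method. -/
theorem accelerated_step_quadratic {μ L A a : ℝ} (hμ : 0 ≤ μ) (hL : 0 ≤ L) (hA : 0 ≤ A)
    (ha : 0 < a) (hLa : L * a ^ 2 = (A + a) * (1 + μ * A)) {x y c p x' : E}
    (hc : c = (A / (A + a)) • y + (a / (A + a)) • x)
    (hx' : x' = ((A + a) * μ + 1)⁻¹ • (((L + μ) * a) • p - (A * a * L / (A + a)) • y)) (u : E) :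
    (A + a) * (L / 2 * ‖p - c‖ ^ 2) + (1 + μ * (A + a)) / 2 * ‖u - x'‖ ^ 2
      ≤ A * (L * ⟪c - p, y - p⟫ + μ / 2 * ‖y - p‖ ^ 2)
        + a * (L * ⟪c - p, u - p⟫ + μ / 2 * ‖u - p‖ ^ 2) + (1 + μ * A) / 2 * ‖u - x‖ ^ 2 := by
  have hs : 0 < A + a := by positivity
  have hm : 0 < (A + a) * μ + 1 := by positivity
  have hLeq : L = (A + a) * (1 + μ * A) / a ^ 2 := by
    field_simp
    linarith
  set Y := y - p with hY
  set C := c - p with hC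
  set U := u - p with hU
  have hux : u - x = U - ((A + a) / a) • C + (A / a) • Y := by
    have : x = ((A + a) / a) • c - (A / a) • y := by
      rw [hc]
      match_scalars <;> field_simp
      ring
    rw [this, hY, hC, hU]
    match_scalars <;> field_simp
    ring
  have hux' : u - x' = U + (A * a * L / ((A + a) * ((A + a) * μ + 1))) • Y := by
    rw [hx', hY, hU, hLeq]
    match_scalars <;> field_simp
    ring
  have hpc : ‖p - c‖ = ‖C‖ := norm_sub_rev _ _
  have hgap : 0 ≤ ((A + a) * ((L + μ) / 2) * (A * μ * a / ((A + a) * ((A + a) * μ + 1))) ^ 2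
      + μ / 2 * (A * a / (A + a)) * (1 + A * a * L / ((A + a) * ((A + a) * μ + 1))) ^ 2)
        * ‖Y‖ ^ 2 := by
    positivity
  rw [← sub_nonneg]
  refine hgap.trans_eq ?_
  rw [hpc, hux, hux']
  simp only [← real_inner_self_eq_norm_sq, inner_add_left, inner_add_right, inner_sub_left,
    inner_sub_right, real_inner_smul_left, real_inner_smul_right]
  rw [real_inner_comm C U, real_inner_comm Y U, real_inner_comm Y C, hLeq]
  field_simp
  ring

end KeyStep

/-- Lemma 2.3: A_j ψ(y_j) ≤ inf_u { A_j Γ_j(u) + (1/2)‖u − x_0‖² } for all j ≥ 0. -/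
theorem key_inequality
    (μ L : ℝ) (hμ : 0 ≤ μ) (hL : 0 < L)
    {E : Type*} [NormedAddCommGroup E] [InnerProductSpace ℝ E] [FiniteDimensional ℝ E]
    (g : E → ℝ) (g' : E → E) (hg : ∀ x, HasGradientAt g (g' x) x)
    (hgsc : ConvexOn ℝ Set.univ (fun u => g u - μ / 2 * ‖u‖ ^ 2))
    (hgsmooth : ∀ x y : E, ‖g' x - g' y‖ ≤ (L + μ) * ‖x - y‖)
    (h : E → ℝ) (hh : ConvexOn ℝ Set.univ h)
    (τ a A : ℕ → ℝ)
    (hτ0 : τ 0 = 1 / L) (hA0 : A 0 = 0)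
    (ha : ∀ j : ℕ, a j = (τ j + Real.sqrt ((τ j) ^ 2 + 4 * τ j * A j)) / 2)
    (hA : ∀ j : ℕ, A (j + 1) = A j + a j)
    (hτ : ∀ j : ℕ, τ (j + 1) = τ j + μ * a j / L)
    (x y xt yt : ℕ → E)
    (hy0 : y 0 = x 0)
    (hxt : ∀ j : ℕ, xt j = (A j / A (j + 1)) • y j + (a j / A (j + 1)) • x j)
    (hyt : ∀ j : ℕ, ∀ u : E,
      g (xt j) + ⟪g' (xt j), yt (j + 1) - xt j⟫ + h (yt (j + 1))
        + (L + μ) / 2 * ‖yt (j + 1) - xt j‖ ^ 2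
      ≤ g (xt j) + ⟪g' (xt j), u - xt j⟫ + h u + (L + μ) / 2 * ‖u - xt j‖ ^ 2)
    (hy : ∀ j : ℕ, (y (j + 1) = y j ∨ y (j + 1) = yt (j + 1))
      ∧ g (y (j + 1)) + h (y (j + 1)) ≤ g (y j) + h (y j)
      ∧ g (y (j + 1)) + h (y (j + 1)) ≤ g (yt (j + 1)) + h (yt (j + 1)))
    (hx : ∀ j : ℕ, x (j + 1) = (A (j + 1) * μ + 1)⁻¹ •
      (((L + μ) * a j) • yt (j + 1) - (A j * a j * L / A (j + 1)) • y j))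
    (γt γ Γ : ℕ → E → ℝ)
    (hγt : ∀ (j : ℕ) (u : E),
      γt j u = g (xt j) + ⟪g' (xt j), u - xt j⟫ + h u + μ / 2 * ‖u - xt j‖ ^ 2)
    (hγ : ∀ (j : ℕ) (u : E),
      γ j u = γt j (yt (j + 1)) + L * ⟪xt j - yt (j + 1), u - yt (j + 1)⟫
        + μ / 2 * ‖u - yt (j + 1)‖ ^ 2)
    (hΓ0 : ∀ u : E, Γ 0 u = 0)
    (hΓ : ∀ (j : ℕ) (u : E), Γ (j + 1) u = (A j * Γ j u + a j * γ j u) / A (j + 1)) :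
    ∀ j : ℕ, ∀ u : E,
      A j * (g (y j) + h (y j)) ≤ A j * Γ j u + 1 / 2 * ‖u - x 0‖ ^ 2 := by
  have hcoef : ∀ j, 0 ≤ A j ∧ L * τ j = 1 + μ * A j := by
    intro j
    induction j with
    | zero => exact ⟨hA0.ge, by rw [hτ0, hA0]; field_simp; ring⟩
    | succ j ih =>
      obtain ⟨hAj, hτj⟩ := ih
      have hτpos : 0 < τ j := pos_of_mul_pos_right (by rw [hτj]; positivity) hL.le
      have haj : 0 ≤ a j := by rw [ha]; positivity
      refine ⟨by rw [hA]; positivity, ?_⟩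
      rw [hτ, hA]
      field_simp
      linarith
  have hτpos : ∀ j, 0 < τ j := fun j =>
    pos_of_mul_pos_right (by rw [(hcoef j).2]; have := (hcoef j).1; positivity) hL.le
  have hapos : ∀ j, 0 < a j := fun j => by
    have := hτpos j
    rw [ha]
    positivity
  have hasq : ∀ j, L * a j ^ 2 = (A j + a j) * (1 + μ * A j) := fun j => by
    have hAj := (hcoef j).1
    have hτj := hτpos j
    have hsqrt := Real.sq_sqrt (show 0 ≤ τ j ^ 2 + 4 * τ j * A j by positivity)
    have : a j ^ 2 = τ j * (A j + a j) := by
      rw [ha]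
      linear_combination hsqrt / 4
    rw [this, ← (hcoef j).2]
    ring
  suffices hstrong : ∀ j u, A j * (g (y j) + h (y j)) + (1 + μ * A j) / 2 * ‖u - x j‖ ^ 2
      ≤ A j * Γ j u + 1 / 2 * ‖u - x 0‖ ^ 2 by
    intro j u
    have := (hcoef j).1
    exact (le_add_of_nonneg_right (by positivity)).trans (hstrong j u)
  intro j
  induction j with
  | zero => simp [hA0]
  | succ j ih =>
    intro u
    have hAj := (hcoef j).1
    have haj := hapos j
    have hquad := accelerated_step_quadratic hμ hL.le hAj haj (hasq j)
      ((hxt j).trans (by rw [hA])) ((hx j).trans (by rw [hA])) u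
    have hsub := hh.inner_le_of_prox (v := g' (xt j)) (c := xt j) (p := yt (j + 1)) (K := L + μ)
      (fun w => by linarith [hyt j w]) (y j)
    have hlower := hgsc.add_inner_add_sq_le (hg (xt j)) (y j)
    have hupper := le_add_inner_add_sq_of_lipschitz_gradient hg hgsmooth (xt j) (yt (j + 1))
    have hψ := (hy j).2.2
    have hmodel : γ j (y j) ≤ g (y j) + h (y j) := by
      have hsplit : y j - xt j = (y j - yt (j + 1)) - (xt j - yt (j + 1)) :=
        (sub_sub_sub_cancel_right _ _ _).symm
      have hrev := norm_sub_rev (yt (j + 1)) (xt j)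
      have hcomm := real_inner_comm (xt j - yt (j + 1)) (y j - yt (j + 1))
      rw [hγ, hγt, hrev, ← neg_sub (xt j), inner_neg_right]
      rw [hsplit, norm_sub_sq_real, inner_sub_right (g' (xt j))] at hlower
      rw [inner_sub_left, real_inner_smul_left] at hsub
      rw [hcomm] at hlower
      linarith
    have hψ' : g (y (j + 1)) + h (y (j + 1))
        ≤ γt j (yt (j + 1)) + L / 2 * ‖yt (j + 1) - xt j‖ ^ 2 := by
      rw [hγt]
      linarith
    have hΓ' : A (j + 1) * Γ (j + 1) u = A j * Γ j u + a j * γ j u := by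
      rw [hΓ, mul_div_cancel₀]
      rw [hA]
      positivity
    rw [hΓ', hA]
    have h₁ := mul_le_mul_of_nonneg_left hmodel hAj
    have h₂ := mul_le_mul_of_nonneg_left hψ' (add_pos_of_nonneg_of_pos hAj haj).le
    rw [hγ] at h₁ ⊢
    linarith [ih u]
end

section
/- For every integer k ≥ 1, φ(w_k) − φ(x_*) ≤ 2 d_0² / (λ k²), where d_0 = ‖w_0 − x_*‖. -/
open scoped RealInnerProductSpace

/-- The step size `b` is the nonnegative root of `b ^ 2 = lam * (A + b)`. -/
lemma stepsize_sq {lam A b : ℝ} (hlam : 0 ≤ lam) (hA : 0 ≤ A)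
    (hb : b = (lam + Real.sqrt (lam ^ 2 + 4 * lam * A)) / 2) :
    b ^ 2 = lam * (A + b) := by
  have hs := Real.sq_sqrt (show 0 ≤ lam ^ 2 + 4 * lam * A by positivity)
  subst hb
  linear_combination hs / 4

/-- Quadratic growth of the accumulated step sizes. -/
lemma quadratic_growth {lam : ℝ} (hlam : 0 ≤ lam) {b B : ℕ → ℝ} (hB0 : B 0 = 0)
    (hb : ∀ k : ℕ, b (k + 1) = (lam + Real.sqrt (lam ^ 2 + 4 * lam * B k)) / 2)
    (hB : ∀ k : ℕ, B (k + 1) = B k + b (k + 1)) (k : ℕ) :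
    lam * (k : ℝ) ^ 2 / 4 ≤ B k := by
  induction k with
  | zero => simp [hB0]
  | succ k ih =>
    have hsqrt : lam * k ≤ Real.sqrt (lam ^ 2 + 4 * lam * B k) := by
      apply Real.le_sqrt_of_sq_le
      nlinarith [mul_le_mul_of_nonneg_left ih hlam, sq_nonneg lam]
    rw [hB, hb]
    push_cast
    linarith

/-- One step of the accelerated hybrid proximal extragradient method does not increase the
potential `A * (φ w - φ xs) + ‖z - xs‖ ^ 2 / 2`. -/
lemma potential_step_le {E : Type*} [NormedAddCommGroup E] [InnerProductSpace ℝ E]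
    {φ : E → ℝ} {xs w w' wt z zt u : E} {lam A b η : ℝ}
    (hlam : 0 < lam) (hA : 0 ≤ A) (hb : 0 < b) (hbsq : b ^ 2 = lam * (A + b))
    (hzt : zt = (A / (A + b)) • w + (b / (A + b)) • z)
    (hsub : ∀ v : E, φ v ≥ φ wt + ⟪u, v - wt⟫ - η)
    (hcrit : ‖lam • u + wt - zt‖ ^ 2 + 2 * lam * η ≤ ‖zt - wt‖ ^ 2)
    (hw : φ w' ≤ φ wt) :
    (A + b) * (φ w' - φ xs) + ‖z - b • u - xs‖ ^ 2 / 2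
      ≤ A * (φ w - φ xs) + ‖z - xs‖ ^ 2 / 2 := by
  have hAb : 0 < A + b := by positivity
  have hinner : (A + b) * ⟪u, zt⟫ = A * ⟪u, w⟫ + b * ⟪u, z⟫ := by
    rw [hzt, inner_add_right, real_inner_smul_right, real_inner_smul_right]
    field_simp
  have hnorm : ‖z - b • u - xs‖ ^ 2
      = ‖z - xs‖ ^ 2 - 2 * b * (⟪u, z⟫ - ⟪u, xs⟫) + b ^ 2 * ‖u‖ ^ 2 := by
    rw [sub_right_comm, norm_sub_sq_real, real_inner_smul_right, norm_smul, mul_pow,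
      Real.norm_eq_abs, sq_abs, real_inner_comm, inner_sub_right]
    ring
  have herr : lam * ‖u‖ ^ 2 / 2 - (⟪u, zt⟫ - ⟪u, wt⟫) + η ≤ 0 := by
    rw [add_sub_assoc, ← neg_sub zt wt, ← sub_eq_add_neg, norm_sub_sq_real,
      real_inner_smul_left, norm_smul, mul_pow, Real.norm_eq_abs, sq_abs,
      inner_sub_right] at hcrit
    refine nonpos_of_mul_nonpos_right (a := lam) ?_ hlam
    linarith
  have hsubw := mul_le_mul_of_nonneg_left (hsub w) hA
  have hsubx := mul_le_mul_of_nonneg_left (hsub xs) hb.le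
  have hmin := mul_le_mul_of_nonneg_left hw hAb.le
  have herr' := mul_nonpos_of_nonneg_of_nonpos hAb.le herr
  rw [inner_sub_right] at hsubw hsubx
  rw [hnorm, hbsq]
  linarith

/-- Theorem 2.5: φ(w_k) − φ_* ≤ 2 d_0² / (λ k²) for all k ≥ 1, with d_0 = ‖w_0 − x_*‖. -/
theorem ahpe_rate
    {E : Type*} [NormedAddCommGroup E] [InnerProductSpace ℝ E] [FiniteDimensional ℝ E]
    (φ : E → ℝ) (hφ : ConvexOn ℝ Set.univ φ)
    (xs : E) (hxs : ∀ u : E, φ xs ≤ φ u)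
    (lam : ℝ) (hlam : 0 < lam)
    (b B : ℕ → ℝ) (w z zt wt ut : ℕ → E) (η : ℕ → ℝ)
    (hz0 : z 0 = w 0) (hB0 : B 0 = 0)
    (hb : ∀ k : ℕ, b (k + 1) = (lam + Real.sqrt (lam ^ 2 + 4 * lam * B k)) / 2)
    (hB : ∀ k : ℕ, B (k + 1) = B k + b (k + 1))
    (hzt : ∀ k : ℕ,
      zt (k + 1) = (B k / B (k + 1)) • w k + (b (k + 1) / B (k + 1)) • z k)
    (hη : ∀ k : ℕ, 0 ≤ η (k + 1))
    (hsub : ∀ k : ℕ, ∀ u : E,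
      φ u ≥ φ (wt (k + 1)) + ⟪ut (k + 1), u - wt (k + 1)⟫ - η (k + 1))
    (hcrit : ∀ k : ℕ,
      ‖lam • ut (k + 1) + wt (k + 1) - zt (k + 1)‖ ^ 2 + 2 * lam * η (k + 1)
        ≤ 0.9 * ‖zt (k + 1) - wt (k + 1)‖ ^ 2)
    (hznext : ∀ k : ℕ, z (k + 1) = z k - b (k + 1) • ut (k + 1))
    (hw : ∀ k : ℕ, (w (k + 1) = w k ∨ w (k + 1) = wt (k + 1))
      ∧ φ (w (k + 1)) ≤ φ (w k) ∧ φ (w (k + 1)) ≤ φ (wt (k + 1))) :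
    ∀ k : ℕ, 1 ≤ k → φ (w k) - φ xs ≤ 2 * ‖w 0 - xs‖ ^ 2 / (lam * (k : ℝ) ^ 2) := by
  have hgrowth := quadratic_growth hlam.le hB0 hb hB
  have hB_nonneg (k : ℕ) : 0 ≤ B k := le_trans (by positivity) (hgrowth k)
  have hpotential (k : ℕ) :
      B k * (φ (w k) - φ xs) + ‖z k - xs‖ ^ 2 / 2 ≤ ‖w 0 - xs‖ ^ 2 / 2 := by
    induction k with
    | zero => simp [hB0, hz0]
    | succ k ih =>
      have hb_pos : 0 < b (k + 1) := by rw [hb]; positivity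
      have hzt' := hzt k
      rw [hB] at hzt'
      rw [hB, hznext]
      refine (potential_step_le hlam (hB_nonneg k) hb_pos
        (stepsize_sq hlam.le (hB_nonneg k) (hb k)) hzt' (hsub k) ?_ (hw k).2.2).trans ih
      linarith [hcrit k, sq_nonneg ‖zt (k + 1) - wt (k + 1)‖]
  intro k hk
  have hk' : (0 : ℝ) < k := by exact_mod_cast hk
  rw [le_div_iff₀ (by positivity)]
  have hgap := mul_le_mul_of_nonneg_right (hgrowth k) (sub_nonneg.2 (hxs (w k)))
  linarith [hpotential k, sq_nonneg ‖z k - xs‖]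
end

section
/- Let ε̄ > 0 and set d_0 = ‖w_0 − x_*‖. For every integer k ≥ 1 with k ≥ √2 · d_0 / √(λ ε̄), one has φ(w_k) − φ(x_*) ≤ ε̄. -/
open scoped RealInnerProductSpace

/-- One step of an accelerated hybrid proximal extragradient method does not increase the potential
`B * (φ w - φ x) + ‖z - x‖ ^ 2 / 2`. -/
theorem ahpe_potential_step {E : Type*} [NormedAddCommGroup E] [InnerProductSpace ℝ E]
    {φ : E → ℝ} {x w w' z zt wt u : E} {lam b B η : ℝ} (hlam : 0 < lam) (hb : 0 < b) (hB : 0 ≤ B)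
    (hbB : b ^ 2 = lam * (B + b))
    (hzt : zt = (B / (B + b)) • w + (b / (B + b)) • z)
    (hsub : ∀ v : E, φ wt + ⟪u, v - wt⟫ - η ≤ φ v)
    (hcrit : ‖lam • u + wt - zt‖ ^ 2 + 2 * lam * η ≤ ‖zt - wt‖ ^ 2)
    (hw : φ w' ≤ φ wt) :
    (B + b) * (φ w' - φ x) + ‖z - b • u - x‖ ^ 2 / 2
      ≤ B * (φ w - φ x) + ‖z - x‖ ^ 2 / 2 := by
  have hBb : 0 < B + b := by positivity
  have hcomb : (B + b) * ⟪u, zt⟫ = B * ⟪u, w⟫ + b * ⟪u, z⟫ := by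
    rw [hzt, inner_add_right, real_inner_smul_right, real_inner_smul_right]
    field_simp
  have hsq : ‖z - b • u - x‖ ^ 2
      = ‖z - x‖ ^ 2 - 2 * b * (⟪u, z⟫ - ⟪u, x⟫) + b ^ 2 * ‖u‖ ^ 2 := by
    rw [show z - b • u - x = (z - x) - b • u by abel, norm_sub_sq_real, real_inner_smul_right,
      real_inner_comm, inner_sub_right, norm_smul, mul_pow, Real.norm_eq_abs, sq_abs]
    ring
  have hres : ‖lam • u + wt - zt‖ ^ 2
      = lam ^ 2 * ‖u‖ ^ 2 - 2 * lam * (⟪u, zt⟫ - ⟪u, wt⟫) + ‖zt - wt‖ ^ 2 := by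
    rw [show lam • u + wt - zt = lam • u - (zt - wt) by abel, norm_sub_sq_real,
      real_inner_smul_left, inner_sub_right, norm_smul, mul_pow, Real.norm_eq_abs, sq_abs]
    ring
  have herr : lam * ‖u‖ ^ 2 / 2 - (⟪u, zt⟫ - ⟪u, wt⟫) + η ≤ 0 := by
    rw [hres] at hcrit
    refine nonpos_of_mul_nonpos_right ?_ hlam
    linarith
  have hsub_w := mul_le_mul_of_nonneg_left (hsub w) hB
  have hsub_x := mul_le_mul_of_nonneg_left (hsub x) hb.le
  rw [inner_sub_right] at hsub_w hsub_x
  have hdecr := mul_le_mul_of_nonneg_left hw hBb.le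
  have herr' := mul_nonpos_of_nonneg_of_nonpos hBb.le herr
  rw [hsq, hbB]
  linarith

/-- If k ≥ √2 d_0 / √(λ ε̄), then w_k is an ε̄-solution. -/
theorem ahpe_eps_solution
    {E : Type*} [NormedAddCommGroup E] [InnerProductSpace ℝ E] [FiniteDimensional ℝ E]
    (φ : E → ℝ) (hφ : ConvexOn ℝ Set.univ φ)
    (xs : E) (hxs : ∀ u : E, φ xs ≤ φ u)
    (lam : ℝ) (hlam : 0 < lam)
    (b B : ℕ → ℝ) (w z zt wt ut : ℕ → E) (η : ℕ → ℝ)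
    (hz0 : z 0 = w 0) (hB0 : B 0 = 0)
    (hb : ∀ k : ℕ, b (k + 1) = (lam + Real.sqrt (lam ^ 2 + 4 * lam * B k)) / 2)
    (hB : ∀ k : ℕ, B (k + 1) = B k + b (k + 1))
    (hzt : ∀ k : ℕ,
      zt (k + 1) = (B k / B (k + 1)) • w k + (b (k + 1) / B (k + 1)) • z k)
    (hη : ∀ k : ℕ, 0 ≤ η (k + 1))
    (hsub : ∀ k : ℕ, ∀ u : E,
      φ u ≥ φ (wt (k + 1)) + ⟪ut (k + 1), u - wt (k + 1)⟫ - η (k + 1))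
    (hcrit : ∀ k : ℕ,
      ‖lam • ut (k + 1) + wt (k + 1) - zt (k + 1)‖ ^ 2 + 2 * lam * η (k + 1)
        ≤ 0.9 * ‖zt (k + 1) - wt (k + 1)‖ ^ 2)
    (hznext : ∀ k : ℕ, z (k + 1) = z k - b (k + 1) • ut (k + 1))
    (hw : ∀ k : ℕ, (w (k + 1) = w k ∨ w (k + 1) = wt (k + 1))
      ∧ φ (w (k + 1)) ≤ φ (w k) ∧ φ (w (k + 1)) ≤ φ (wt (k + 1))) :
    ∀ ε : ℝ, 0 < ε → ∀ k : ℕ, 1 ≤ k →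
      Real.sqrt 2 * ‖w 0 - xs‖ / Real.sqrt (lam * ε) ≤ (k : ℝ) →
      φ (w k) - φ xs ≤ ε := by
  have hstep : ∀ k, 0 ≤ B k → 0 < b (k + 1) ∧ b (k + 1) ^ 2 = lam * (B k + b (k + 1)) := by
    intro k hk
    have hs := Real.sq_sqrt (show 0 ≤ lam ^ 2 + 4 * lam * B k by positivity)
    rw [hb k]
    exact ⟨by positivity, by linarith⟩
  have hgrowth : ∀ k : ℕ, lam * (k : ℝ) ^ 2 / 4 ≤ B k := by
    intro k
    induction k with
    | zero => simp [hB0]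
    | succ k ih =>
      have hs : lam * k ≤ Real.sqrt (lam ^ 2 + 4 * lam * B k) := by
        apply Real.le_sqrt_of_sq_le
        linarith [mul_le_mul_of_nonneg_left ih hlam.le, sq_nonneg lam]
      rw [hB, hb]
      push_cast
      linarith
  have hBnn : ∀ k, 0 ≤ B k := fun k => le_trans (by positivity) (hgrowth k)
  have hpot : ∀ k, B k * (φ (w k) - φ xs) + ‖z k - xs‖ ^ 2 / 2 ≤ ‖w 0 - xs‖ ^ 2 / 2 := by
    intro k
    induction k with
    | zero => simp [hB0, hz0]
    | succ k ih =>
      obtain ⟨hbpos, hbB⟩ := hstep k (hBnn k)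
      refine le_trans ?_ ih
      rw [hB, hznext]
      refine ahpe_potential_step hlam hbpos (hBnn k) hbB (by rw [hzt, hB]) (hsub k)
        ((hcrit k).trans ?_) (hw k).2.2
      linarith [sq_nonneg ‖zt (k + 1) - wt (k + 1)‖]
  intro ε hε k hk hkε
  have hkpos : (0 : ℝ) < k := by exact_mod_cast hk
  have hd : 2 * ‖w 0 - xs‖ ^ 2 ≤ k ^ 2 * (lam * ε) := by
    rw [div_le_iff₀ (by positivity)] at hkε
    have hsq := pow_le_pow_left₀ (by positivity) hkε 2
    rwa [mul_pow, mul_pow, Real.sq_sqrt zero_le_two, Real.sq_sqrt (by positivity)] at hsq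
  have hgap := mul_le_mul_of_nonneg_right (hgrowth k) (sub_nonneg.2 (hxs (w k)))
  have hc : 0 < lam * (k : ℝ) ^ 2 / 4 := by positivity
  refine le_of_mul_le_mul_left ?_ hc
  linarith [hpot k, sq_nonneg ‖z k - xs‖]
end

section
/- One has φ(w̃) + (1/(2λ))‖w̃ − z̃‖² − φ(ẑ) − (1/(2λ))‖ẑ − z̃‖² ≤ (0.9/(2λ))‖z̃ − w̃‖²; that is, w̃ solves the proximal subproblem min_u { φ(u) + (1/(2λ))‖u − z̃‖² } with relative accuracy 0.9/(2λ) times ‖z̃ − w̃‖². -/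
open scoped RealInnerProductSpace

/-- Relative accuracy of w̃ for the proximal subproblem min_v { φ(v) + (1/(2λ))‖v − z̃‖² }. -/
theorem relative_accuracy
    {E : Type*} [NormedAddCommGroup E] [InnerProductSpace ℝ E] [FiniteDimensional ℝ E]
    (φ : E → ℝ) (hφ : ConvexOn ℝ Set.univ φ)
    (lam : ℝ) (hlam : 0 < lam)
    (zt wt u : E) (η : ℝ) (hη : 0 ≤ η)
    (hsub : ∀ v : E, φ v ≥ φ wt + ⟪u, v - wt⟫ - η)
    (hcrit : ‖lam • u + wt - zt‖ ^ 2 + 2 * lam * η ≤ 0.9 * ‖zt - wt‖ ^ 2)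
    (zh : E)
    (hzh : ∀ v : E, φ zh + 1 / (2 * lam) * ‖zh - zt‖ ^ 2 ≤ φ v + 1 / (2 * lam) * ‖v - zt‖ ^ 2) :
    φ wt + 1 / (2 * lam) * ‖wt - zt‖ ^ 2 - φ zh - 1 / (2 * lam) * ‖zh - zt‖ ^ 2
      ≤ 0.9 / (2 * lam) * ‖zt - wt‖ ^ 2 := by
  have hv := hsub zh
  have hsq : 0 ≤ ‖(lam • u + wt - zt) + (zh - wt)‖ ^ 2 := sq_nonneg _
  have hin : ⟪lam • u + wt - zt, zh - wt⟫ = lam * ⟪u, zh - wt⟫ + ⟪wt - zt, zh - wt⟫ := by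
    rw [add_sub_assoc, inner_add_left, real_inner_smul_left]
  have hexp : ‖zh - zt‖ ^ 2 =
      ‖wt - zt‖ ^ 2 + 2 * ⟪wt - zt, zh - wt⟫ + ‖zh - wt‖ ^ 2 := by
    rw [← norm_add_sq_real, sub_add_sub_cancel']
  rw [norm_add_sq_real, hin] at hsq
  have hscaled : 2 * lam * (φ wt - φ zh) ≤ 2 * lam * (η - ⟪u, zh - wt⟫) :=
    mul_le_mul_of_nonneg_left (by linarith) (by positivity)
  have key : 2 * lam * (φ wt - φ zh) + ‖wt - zt‖ ^ 2 - ‖zh - zt‖ ^ 2 ≤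
      0.9 * ‖zt - wt‖ ^ 2 := by
    rw [hexp]
    linarith
  have hdiv := div_le_div_of_nonneg_right key (by positivity : 0 ≤ 2 * lam)
  calc
    _ = (2 * lam * (φ wt - φ zh) + ‖wt - zt‖ ^ 2 - ‖zh - zt‖ ^ 2) / (2 * lam) := by
      field_simp
      ring
    _ ≤ 0.9 * ‖zt - wt‖ ^ 2 / (2 * lam) := hdiv
    _ = _ := by ring
end

section
/- One has ψ(y) − Γ(x̂) ≤ (1/(2A))‖x̂ − x_0‖² ≤ (1/(A − 2λ))‖y − x_0‖². -/
open scoped RealInnerProductSpace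

/-- Quadratic growth of a strongly convex function away from a minimizer. -/
theorem StrongConvexOn.add_sq_norm_le_of_isMinOn
    {E : Type*} [NormedAddCommGroup E] [NormedSpace ℝ E] {s : Set E} {m : ℝ} {f : E → ℝ}
    (hf : StrongConvexOn s m f) {x y : E} (hx : x ∈ s) (hy : y ∈ s) (hmin : IsMinOn f s x) :
    f x + m / 2 * ‖y - x‖ ^ 2 ≤ f y := by
  set K := m / 2 * ‖y - x‖ ^ 2 with hK
  have growth : ∀ t : ℝ, 0 < t → t ≤ 1 → (1 - t) * K ≤ f y - f x := by
    intro t ht ht1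
    have hconv := hf.2 hx hy (sub_nonneg.2 ht1) ht.le (sub_add_cancel 1 t)
    have hle : f x ≤ f ((1 - t) • x + t • y) :=
      hmin (hf.1 hx hy (sub_nonneg.2 ht1) ht.le (sub_add_cancel 1 t))
    simp only [smul_eq_mul, norm_sub_rev x y, ← hK] at hconv
    refine le_of_mul_le_mul_left ?_ ht
    linarith
  by_contra! hlt
  have hD : f x ≤ f y := hmin hy
  have hKpos : 0 < K := by linarith
  have h := growth ((K - (f y - f x)) / (2 * K)) (div_pos (by linarith) (by linarith))
    ((div_le_one (by linarith)).2 (by linarith))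
  have heq : (1 - (K - (f y - f x)) / (2 * K)) * K = (K + (f y - f x)) / 2 := by
    field_simp
    ring
  linarith

/-- Lemma 2.7(a): ψ(y) − Γ(x̂) ≤ (1/(2A))‖x̂ − x_0‖² ≤ (1/(A − 2λ))‖y − x_0‖². -/
theorem bound_via_min
    {E : Type*} [NormedAddCommGroup E] [InnerProductSpace ℝ E] [FiniteDimensional ℝ E]
    (lam : ℝ) (hlam : 0 < lam)
    (ψ : E → ℝ) (x0 y : E)
    (A : ℝ) (hA : 3 * lam ≤ A)
    (Γ : E → ℝ)
    (hΓsc : ConvexOn ℝ Set.univ (fun u => Γ u - 1 / (2 * lam) * ‖u‖ ^ 2))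
    (hΓle : ∀ u : E, Γ u ≤ ψ u)
    (hmin : ∀ u : E, A * ψ y ≤ A * Γ u + 1 / 2 * ‖u - x0‖ ^ 2)
    (xh : E) (hxh : ∀ u : E, Γ xh ≤ Γ u) :
    ψ y - Γ xh ≤ 1 / (2 * A) * ‖xh - x0‖ ^ 2
    ∧ 1 / (2 * A) * ‖xh - x0‖ ^ 2 ≤ 1 / (A - 2 * lam) * ‖y - x0‖ ^ 2 := by
  have hApos : 0 < A := by linarith
  have hA2 : 0 < A - 2 * lam := by linarith
  have hfirst : ψ y - Γ xh ≤ 1 / (2 * A) * ‖xh - x0‖ ^ 2 := by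
    have h := hmin xh
    rw [one_div_mul_eq_div, le_div_iff₀ (by linarith)]
    linarith
  refine ⟨hfirst, ?_⟩
  have hstrong : StrongConvexOn Set.univ (1 / lam) Γ := by
    rw [strongConvexOn_iff_convex]
    convert hΓsc using 4
    field_simp
  have hgrowth := hstrong.add_sq_norm_le_of_isMinOn (Set.mem_univ xh) (Set.mem_univ y)
    (fun u _ => hxh u)
  have hdist : 1 / lam / 2 * ‖y - xh‖ ^ 2 ≤ 1 / (2 * A) * ‖xh - x0‖ ^ 2 := by
    linarith [hΓle y]
  have hdist' : A * ‖y - xh‖ ^ 2 ≤ lam * ‖xh - x0‖ ^ 2 := by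
    field_simp at hdist
    linarith
  have htri : ‖xh - x0‖ ^ 2 ≤ 2 * ‖y - xh‖ ^ 2 + 2 * ‖y - x0‖ ^ 2 := by
    have h := norm_sub_le_norm_sub_add_norm_sub xh y x0
    rw [norm_sub_rev xh y] at h
    nlinarith [sq_nonneg (‖y - xh‖ - ‖y - x0‖), norm_nonneg (xh - x0)]
  rw [one_div_mul_eq_div, one_div_mul_eq_div, div_le_div_iff₀ (by linarith) hA2]
  nlinarith [mul_le_mul_of_nonneg_left htri hApos.le]
end

section
/- One has ‖v‖ ≤ 3‖y − x_0‖/(2A), where v = (x_0 − x)/A. -/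
open scoped RealInnerProductSpace

/-- Parallelogram-type identity for the squared distance to `z` along a segment. -/
lemma norm_sq_segment_sub {E : Type*} [NormedAddCommGroup E] [InnerProductSpace ℝ E]
    (x y z : E) (t : ℝ) :
    ‖(1 - t) • x + t • y - z‖ ^ 2 =
      (1 - t) * ‖x - z‖ ^ 2 + t * ‖y - z‖ ^ 2 - t * (1 - t) * ‖y - x‖ ^ 2 := by
  have hu : (1 - t) • x + t • y - z = (1 - t) • (x - z) + t • (y - z) := by module
  have hw : y - x = (y - z) - (x - z) := by abel
  rw [hu, hw, norm_add_sq_real, norm_sub_sq_real (y - z), norm_smul, norm_smul, inner_smul_left,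
    inner_smul_right, real_inner_comm (x - z) (y - z), mul_pow, mul_pow, Real.norm_eq_abs,
    Real.norm_eq_abs, sq_abs, sq_abs]
  simp only [conj_trivial]
  ring

/-- Lemma 2.7(b): ‖v‖ ≤ 3‖y − x_0‖/(2A) where v = (x_0 − x)/A. -/
theorem v_bound
    {E : Type*} [NormedAddCommGroup E] [InnerProductSpace ℝ E] [FiniteDimensional ℝ E]
    (lam : ℝ) (hlam : 0 < lam)
    (ψ : E → ℝ) (x0 y : E)
    (A : ℝ) (hA : 3 * lam ≤ A)
    (Γ : E → ℝ)
    (hΓsc : ConvexOn ℝ Set.univ (fun u => Γ u - 1 / (2 * lam) * ‖u‖ ^ 2))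
    (hΓle : ∀ u : E, Γ u ≤ ψ u)
    (hmin : ∀ u : E, A * ψ y ≤ A * Γ u + 1 / 2 * ‖u - x0‖ ^ 2)
    (x : E)
    (hx : ∀ u : E, A * Γ x + 1 / 2 * ‖x - x0‖ ^ 2 ≤ A * Γ u + 1 / 2 * ‖u - x0‖ ^ 2) :
    ‖A⁻¹ • (x0 - x)‖ ≤ 3 * ‖y - x0‖ / (2 * A) := by
  have hA0 : 0 < A := by linarith
  have hAc : 3 / 2 ≤ A * (1 / (2 * lam)) := by
    rw [mul_one_div, le_div_iff₀ (by positivity)]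
    linarith
  have hgap : A * Γ y ≤ A * Γ x + 1 / 2 * ‖x - x0‖ ^ 2 :=
    (mul_le_mul_of_nonneg_left (hΓle y) hA0.le).trans (hmin x)
  have hsegment : ∀ t : ℝ, 0 < t → t < 1 → 4 * (1 - t) * ‖y - x‖ ^ 2 ≤ ‖y - x0‖ ^ 2 := by
    intro t ht0 ht1
    have hconv := hΓsc.2 (Set.mem_univ x) (Set.mem_univ y) (sub_nonneg.2 ht1.le) ht0.le
      (sub_add_cancel 1 t)
    have hnorm := norm_sq_segment_sub x y 0 t
    simp only [sub_zero] at hnorm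
    simp only [smul_eq_mul, hnorm] at hconv
    have hopt := hx ((1 - t) • x + t • y)
    rw [norm_sq_segment_sub] at hopt
    have hAconv := mul_le_mul_of_nonneg_left hconv hA0.le
    have hcurv := mul_le_mul_of_nonneg_right hAc
      (show 0 ≤ t * (1 - t) * ‖y - x‖ ^ 2 from
        mul_nonneg (mul_nonneg ht0.le (sub_nonneg.2 ht1.le)) (sq_nonneg _))
    have hgap_t := mul_le_mul_of_nonneg_left hgap ht0.le
    refine le_of_mul_le_mul_left ?_ ht0
    linarith
  have hsq : 4 * ‖y - x‖ ^ 2 ≤ ‖y - x0‖ ^ 2 := by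
    have hlim : Filter.Tendsto (fun t : ℝ => 4 * (1 - t) * ‖y - x‖ ^ 2)
        (nhdsWithin 0 (Set.Ioi 0)) (nhds (4 * (1 - 0) * ‖y - x‖ ^ 2)) :=
      (Continuous.tendsto (by fun_prop) 0).mono_left nhdsWithin_le_nhds
    rw [sub_zero, mul_one] at hlim
    refine le_of_tendsto hlim ?_
    filter_upwards [Ioo_mem_nhdsGT (zero_lt_one' ℝ)] with t ht using hsegment t ht.1 ht.2
  have hdist : 2 * ‖y - x‖ ≤ ‖y - x0‖ :=
    abs_le_of_sq_le_sq' (by linarith) (norm_nonneg _) |>.2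
  have htri : ‖x0 - x‖ ≤ ‖y - x‖ + ‖y - x0‖ := by
    simpa using norm_sub_le (y - x) (y - x0)
  rw [norm_smul, Real.norm_of_nonneg (inv_nonneg.2 hA0.le), inv_mul_eq_div,
    div_le_div_iff₀ hA0 (by positivity)]
  nlinarith
end

section
/- One has ‖y − x̂‖² ≤ (λ/A)‖x̂ − x_0‖². -/
open scoped RealInnerProductSpace

/-- A strongly convex function grows at least quadratically away from a minimizer. -/
theorem StrongConvexOn.add_sq_norm_sub_le_of_isMinOn
    {E : Type*} [NormedAddCommGroup E] [NormedSpace ℝ E] {s : Set E} {m : ℝ} {f : E → ℝ} {x y : E}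
    (hf : StrongConvexOn s m f) (hx : x ∈ s) (hmin : IsMinOn f s x) (hy : y ∈ s) :
    f x + m / 2 * ‖y - x‖ ^ 2 ≤ f y := by
  set c := m / 2 * ‖y - x‖ ^ 2 with hc
  have hxy : f x ≤ f y := hmin hy
  have key : ∀ t : ℝ, 0 < t → t < 1 → (1 - t) * c ≤ f y - f x := by
    intro t ht0 ht1
    have hconv := hf.2 hx hy (sub_pos.2 ht1).le ht0.le (by ring)
    have hle : f x ≤ f ((1 - t) • x + t • y) :=
      hmin (hf.1 hx hy (sub_pos.2 ht1).le ht0.le (by ring))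
    simp only [smul_eq_mul, norm_sub_rev x y, ← hc] at hconv
    refine le_of_mul_le_mul_left ?_ ht0
    linarith
  by_contra! hlt
  have hc0 : 0 < c := by linarith
  have h := key ((c - (f y - f x)) / (2 * c)) (div_pos (by linarith) (by linarith))
    ((div_lt_one (by linarith)).2 (by linarith))
  have hmul : (1 - (c - (f y - f x)) / (2 * c)) * c = (c + (f y - f x)) / 2 := by
    field_simp
    ring
  linarith

/-- Intermediate bound in Lemma 2.7(a): ‖y − x̂‖² ≤ (λ/A)‖x̂ − x_0‖². -/
theorem y_xhat_bound
    {E : Type*} [NormedAddCommGroup E] [InnerProductSpace ℝ E] [FiniteDimensional ℝ E]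
    (lam : ℝ) (hlam : 0 < lam)
    (ψ : E → ℝ) (x0 y : E)
    (A : ℝ) (hA : 0 < A)
    (Γ : E → ℝ)
    (hΓsc : ConvexOn ℝ Set.univ (fun u => Γ u - 1 / (2 * lam) * ‖u‖ ^ 2))
    (hΓle : ∀ u : E, Γ u ≤ ψ u)
    (hmin : ∀ u : E, A * ψ y ≤ A * Γ u + 1 / 2 * ‖u - x0‖ ^ 2)
    (xh : E) (hxh : ∀ u : E, Γ xh ≤ Γ u) :
    ‖y - xh‖ ^ 2 ≤ lam / A * ‖xh - x0‖ ^ 2 := by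
  have hsc : StrongConvexOn Set.univ (1 / lam) Γ := by
    rw [strongConvexOn_iff_convex]
    convert hΓsc using 4
    field_simp
  have hgrowth := hsc.add_sq_norm_sub_le_of_isMinOn (Set.mem_univ xh) (fun u _ => hxh u)
    (Set.mem_univ y)
  have hA_growth := mul_le_mul_of_nonneg_left (hgrowth.trans (hΓle y)) hA.le
  have hgap : A * (1 / lam / 2 * ‖y - xh‖ ^ 2) ≤ 1 / 2 * ‖xh - x0‖ ^ 2 := by
    linarith [hmin xh]
  calc ‖y - xh‖ ^ 2
      = 2 * lam / A * (A * (1 / lam / 2 * ‖y - xh‖ ^ 2)) := by field_simp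
    _ ≤ 2 * lam / A * (1 / 2 * ‖xh - x0‖ ^ 2) := by gcongr
    _ = lam / A * ‖xh - x0‖ ^ 2 := by ring
end

section
/- One has ‖y − x‖² ≤ (λ/(λ + A))‖y − x_0‖². -/
open scoped RealInnerProductSpace

/-- The proximal objective of a `1 / lam`-strongly convex function is
`(A / lam + 1)`-strongly convex. -/
theorem strongConvexOn_mul_add_half_sq_norm_sub
    {E : Type*} [NormedAddCommGroup E] [InnerProductSpace ℝ E] {lam A : ℝ} (hA : 0 ≤ A)
    {Γ : E → ℝ} (hΓ : ConvexOn ℝ Set.univ (fun u => Γ u - 1 / (2 * lam) * ‖u‖ ^ 2)) (x0 : E) :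
    StrongConvexOn Set.univ (A / lam + 1) (fun u => A * Γ u + 1 / 2 * ‖u - x0‖ ^ 2) := by
  rw [strongConvexOn_iff_convex]
  have hlin : ConvexOn ℝ Set.univ (fun u : E => (-innerₗ E x0) u) :=
    (-innerₗ E x0).convexOn convex_univ
  refine (((hΓ.smul hA).add hlin).add_const (1 / 2 * ‖x0‖ ^ 2)).congr fun u _ => ?_
  simp only [Pi.add_apply, smul_eq_mul, LinearMap.neg_apply, innerₗ_apply_apply,
    norm_sub_sq_real, real_inner_comm x0 u]
  ring

/-- Intermediate bound in Lemma 2.7(b): ‖y − x‖² ≤ (λ/(λ + A))‖y − x_0‖². -/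
theorem y_x_bound
    {E : Type*} [NormedAddCommGroup E] [InnerProductSpace ℝ E] [FiniteDimensional ℝ E]
    (lam : ℝ) (hlam : 0 < lam)
    (ψ : E → ℝ) (x0 y : E)
    (A : ℝ) (hA : 0 < A)
    (Γ : E → ℝ)
    (hΓsc : ConvexOn ℝ Set.univ (fun u => Γ u - 1 / (2 * lam) * ‖u‖ ^ 2))
    (hΓle : ∀ u : E, Γ u ≤ ψ u)
    (hmin : ∀ u : E, A * ψ y ≤ A * Γ u + 1 / 2 * ‖u - x0‖ ^ 2)
    (x : E)
    (hx : ∀ u : E, A * Γ x + 1 / 2 * ‖x - x0‖ ^ 2 ≤ A * Γ u + 1 / 2 * ‖u - x0‖ ^ 2) :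
    ‖y - x‖ ^ 2 ≤ lam / (lam + A) * ‖y - x0‖ ^ 2 := by
  have hgrowth := (strongConvexOn_mul_add_half_sq_norm_sub hA.le hΓsc x0).add_sq_norm_le_of_isMinOn
    (Set.mem_univ x) (Set.mem_univ y) (isMinOn_univ_iff.2 hx)
  have hy := mul_le_mul_of_nonneg_left (hΓle y) hA.le
  have hbound : (A / lam + 1) * ‖y - x‖ ^ 2 ≤ ‖y - x0‖ ^ 2 := by
    linarith [hmin x]
  rw [div_add_one hlam.ne', div_mul_eq_mul_div, div_le_iff₀ hlam] at hbound
  rw [div_mul_eq_mul_div, le_div_iff₀ (by positivity)]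
  linarith
end

section
/- For every u ∈ E, φ(u) ≥ φ(y) + ⟨v̂, u − y⟩ − ε, and ‖λ v̂ + y − x_0‖² + 2λ ε ≤ (9/16)‖y − x_0‖²; in particular ‖λ v̂ + y − x_0‖² + 2λ ε ≤ 0.9 ‖y − x_0‖², so the triple (y, v̂, ε) satisfies the A-HPE acceptance criteria. -/
open scoped RealInnerProductSpace

/-- Subtracting half a squared distance to `x₀` preserves the convexity obtained by subtracting half
the squared norm: the two functions differ by an affine one. -/
theorem ConvexOn.sub_const_mul_sq_norm_sub
    {E : Type*} [NormedAddCommGroup E] [InnerProductSpace ℝ E] {f : E → ℝ} {m : ℝ}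
    (hf : ConvexOn ℝ Set.univ (fun u => f u - m * ‖u‖ ^ 2)) (x₀ : E) :
    ConvexOn ℝ Set.univ (fun u => f u - m * ‖u - x₀‖ ^ 2) := by
  have h := (hf.add (((2 * m) • innerₛₗ ℝ x₀).convexOn convex_univ)).add_const (-(m * ‖x₀‖ ^ 2))
  refine h.congr fun u _ => ?_
  simp only [Pi.add_apply, LinearMap.smul_apply, innerₛₗ_apply_apply, smul_eq_mul,
    norm_sub_sq_real, real_inner_comm u x₀]
  ring

/-- First-order optimality condition for a proximal step: if `x` minimizes
`g + (c / 2) ‖· - x₀‖ ^ 2` with `g` convex, then `-c • (x - x₀)` is a subgradient of `g` at `x`. -/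
theorem ConvexOn.subgradient_of_isMin_add_sq_norm_sub
    {E : Type*} [NormedAddCommGroup E] [InnerProductSpace ℝ E] {g : E → ℝ} {c : ℝ} {x₀ x : E}
    (hg : ConvexOn ℝ Set.univ g)
    (hx : ∀ u, g x + c / 2 * ‖x - x₀‖ ^ 2 ≤ g u + c / 2 * ‖u - x₀‖ ^ 2) (u : E) :
    g x - c * ⟪x - x₀, u - x⟫ ≤ g u := by
  have key : ∀ s ∈ Set.Ioo (0 : ℝ) 1,
      0 ≤ g u - g x + c * ⟪x - x₀, u - x⟫ + s * (c / 2 * ‖u - x‖ ^ 2) := by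
    rintro s ⟨hs0, hs1⟩
    have hconv := hg.2 (Set.mem_univ x) (Set.mem_univ u) (sub_nonneg.2 hs1.le) hs0.le
      (sub_add_cancel 1 s)
    have hmin := hx ((1 - s) • x + s • u)
    have hnorm : ‖(1 - s) • x + s • u - x₀‖ ^ 2
        = ‖x - x₀‖ ^ 2 + 2 * (s * ⟪x - x₀, u - x⟫) + s ^ 2 * ‖u - x‖ ^ 2 := by
      rw [show (1 - s) • x + s • u - x₀ = (x - x₀) + s • (u - x) by module,
        norm_add_sq_real, real_inner_smul_right, norm_smul, mul_pow, Real.norm_eq_abs, sq_abs]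
    rw [hnorm] at hmin
    simp only [smul_eq_mul] at hconv
    refine nonneg_of_mul_nonneg_right (a := s) ?_ hs0
    linarith
  have hlim : Filter.Tendsto
      (fun s : ℝ => g u - g x + c * ⟪x - x₀, u - x⟫ + s * (c / 2 * ‖u - x‖ ^ 2))
      (nhdsWithin 0 (Set.Ioi 0)) (nhds (g u - g x + c * ⟪x - x₀, u - x⟫)) := by
    refine (Continuous.tendsto' (by fun_prop) _ _ (by simp)).mono_left nhdsWithin_le_nhds
  have h := ge_of_tendsto hlim
    (Filter.mem_of_superset (Ioo_mem_nhdsGT zero_lt_one) key)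
  linarith

/-- Proposition 2.8 (core estimate): the triple (y, v̂, ε) satisfies the A-HPE acceptance
criteria, with the sharper bound (9/16)‖y − x_0‖². -/
theorem ahpe_criteria_satisfied
    {E : Type*} [NormedAddCommGroup E] [InnerProductSpace ℝ E] [FiniteDimensional ℝ E]
    (lam : ℝ) (hlam : 0 < lam)
    (φ : E → ℝ) (hφ : ConvexOn ℝ Set.univ φ)
    (x0 y : E)
    (Γ : E → ℝ)
    (hΓsc : ConvexOn ℝ Set.univ (fun u => Γ u - 1 / (2 * lam) * ‖u‖ ^ 2))
    (hΓle : ∀ u : E, Γ u ≤ φ u + 1 / (2 * lam) * ‖u - x0‖ ^ 2)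
    (A : ℝ) (hA : 6 * lam ≤ A)
    (hmin : ∀ u : E,
      A * (φ y + 1 / (2 * lam) * ‖y - x0‖ ^ 2) ≤ A * Γ u + 1 / 2 * ‖u - x0‖ ^ 2)
    (x : E)
    (hx : ∀ u : E, A * Γ x + 1 / 2 * ‖x - x0‖ ^ 2 ≤ A * Γ u + 1 / 2 * ‖u - x0‖ ^ 2)
    (v vh : E) (ε : ℝ)
    (hv : v = A⁻¹ • (x0 - x))
    (hvh : vh = v + lam⁻¹ • (x0 - x))
    (hε : ε = φ y - (Γ x - 1 / (2 * lam) * ‖x - x0‖ ^ 2) - ⟪vh, y - x⟫) :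
    (∀ u : E, φ u ≥ φ y + ⟪vh, u - y⟫ - ε)
    ∧ ‖lam • vh + y - x0‖ ^ 2 + 2 * lam * ε ≤ 9 / 16 * ‖y - x0‖ ^ 2
    ∧ ‖lam • vh + y - x0‖ ^ 2 + 2 * lam * ε ≤ 0.9 * ‖y - x0‖ ^ 2 := by
  have hA0 : 0 < A := by linarith
  have hg := hΓsc.sub_const_mul_sq_norm_sub x0
  have hvh' : vh = -(lam⁻¹ + A⁻¹) • (x - x0) := by rw [hvh, hv]; module
  have hsub : ∀ u, Γ x - 1 / (2 * lam) * ‖x - x0‖ ^ 2 + ⟪vh, u - x⟫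
      ≤ Γ u - 1 / (2 * lam) * ‖u - x0‖ ^ 2 := by
    intro u
    have h := hg.subgradient_of_isMin_add_sq_norm_sub (c := lam⁻¹ + A⁻¹) (x₀ := x0) (x := x)
      (fun w => by
        field_simp
        linarith [mul_le_mul_of_nonneg_left (hx w) hlam.le]) u
    rw [hvh', real_inner_smul_left]
    linarith
  have hlower : ∀ u, φ u ≥ φ y + ⟪vh, u - y⟫ - ε := by
    intro u
    have hsplit : ⟪vh, u - x⟫ = ⟪vh, u - y⟫ + ⟪vh, y - x⟫ := by
      rw [← inner_add_right, sub_add_sub_cancel]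
    linarith [hsub u, hΓle u]
  have hε0 : 0 ≤ ε := by simpa using hlower y
  obtain ⟨t, rfl⟩ : ∃ t, lam = t * A := ⟨lam / A, by field_simp⟩
  have ht0 : 0 < t := pos_of_mul_pos_left hlam hA0.le
  have ht : t ≤ 1 / 6 := by nlinarith
  set p := x - x0 with hp
  set q := y - x0 with hq
  have hlv : (t * A) • vh = -(1 + t) • p := by
    rw [hvh', smul_smul]
    congr 1
    field_simp
  have hyx : y - x = q - p := by rw [hp, hq]; abel
  have hinner : t * A * ⟪vh, y - x⟫ = -(1 + t) * (⟪p, q⟫ - ‖p‖ ^ 2) := by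
    rw [← real_inner_smul_left, hlv, hyx, real_inner_smul_left, inner_sub_right,
      real_inner_self_eq_norm_sq]
  have hε_le : 2 * (t * A) * ε ≤ 2 * (1 + t) * ⟪p, q⟫ - (1 + t) * ‖p‖ ^ 2 - ‖q‖ ^ 2 := by
    have hm := hmin x
    have hexp : 2 * (t * A) * ε = 2 * t * (A * φ y - A * Γ x) + ‖p‖ ^ 2
        - 2 * (t * A * ⟪vh, y - x⟫) := by
      rw [hε]; field_simp; ring
    have hm' : 2 * t * (A * φ y - A * Γ x) ≤ t * ‖p‖ ^ 2 - ‖q‖ ^ 2 := by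
      have h := mul_le_mul_of_nonneg_left hm (mul_pos two_pos ht0).le
      have hq' : 2 * t * (A * (1 / (2 * (t * A)) * ‖q‖ ^ 2)) = ‖q‖ ^ 2 := by field_simp
      linarith
    rw [hexp, hinner]
    linarith
  have hnorm : ‖(t * A) • vh + y - x0‖ ^ 2
      = (1 + t) ^ 2 * ‖p‖ ^ 2 - 2 * (1 + t) * ⟪p, q⟫ + ‖q‖ ^ 2 := by
    rw [add_sub_assoc, hlv, norm_add_sq_real, real_inner_smul_left, norm_smul, mul_pow,
      Real.norm_eq_abs, sq_abs]
    ring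
  have hbound : t * (1 + t) * ‖p‖ ^ 2 ≤ 9 / 16 * ‖q‖ ^ 2 := by
    have hprod : 0 ≤ 2 * (t * A) * ε := by positivity
    have hsq : 0 ≤ ‖p - (2 : ℝ) • q‖ ^ 2 := sq_nonneg _
    rw [norm_sub_sq_real, real_inner_smul_right, norm_smul, mul_pow, Real.norm_eq_abs,
      sq_abs] at hsq
    have hpq : (1 + t) * ‖p‖ ^ 2 ≤ 2 * (1 + 2 * t) * ‖q‖ ^ 2 := by nlinarith
    have hcoef : t * (2 * (1 + 2 * t)) ≤ 9 / 16 := by nlinarith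
    nlinarith [mul_le_mul_of_nonneg_left hpq ht0.le,
      mul_le_mul_of_nonneg_right hcoef (sq_nonneg ‖q‖)]
  have hmain : ‖(t * A) • vh + y - x0‖ ^ 2 + 2 * (t * A) * ε ≤ 9 / 16 * ‖q‖ ^ 2 := by
    rw [hnorm]
    linarith
  exact ⟨hlower, hmain, hmain.trans (by gcongr; norm_num)⟩
end

section
/- For every integer j ≥ 1 with j ≥ min{ 2√(6λL), (1/2 + √(λL)) ln(6λL) }, one has A_j ≥ 6λ. -/
/-- Any `c` with `c ^ 2 ≤ t * (c + B)` lies below the larger root of `z ^ 2 = t * (z + B)`. -/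
theorem le_larger_root {t B c : ℝ} (h : c ^ 2 ≤ t * (c + B)) :
    c ≤ (t + Real.sqrt (t ^ 2 + 4 * t * B)) / 2 := by
  have : 2 * c - t ≤ Real.sqrt (t ^ 2 + 4 * t * B) :=
    Real.le_sqrt_of_sq_le (by nlinarith)
  linarith

/-- `B` grows at least as fast as the recurrence `B (n + 1) = B n + b`, where `b` is the larger
root of `b ^ 2 = (1 + x ^ 2 * B n) * (b + B n)`. -/
def GrowsByRoot (x : ℝ) (B : ℕ → ℝ) : Prop :=
  ∀ (n : ℕ) (c : ℝ), c ^ 2 ≤ (1 + x ^ 2 * B n) * (c + B n) → B n + c ≤ B (n + 1)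

namespace GrowsByRoot

variable {x : ℝ} {B : ℕ → ℝ}

theorem nonneg (hB : GrowsByRoot x B) (hB0 : B 0 = 0) (n : ℕ) : 0 ≤ B n := by
  induction n with
  | zero => exact hB0.ge
  | succ n ih =>
    have := hB n 0 (by rw [zero_pow two_ne_zero]; positivity)
    linarith

theorem half_le_sqrt (hB : GrowsByRoot x B) (hB0 : B 0 = 0) (n : ℕ) :
    (n : ℝ) / 2 ≤ Real.sqrt (B n) := by
  induction n with
  | zero => simp
  | succ n ih =>
    have hn := hB.nonneg hB0 n
    have hs := Real.sqrt_nonneg (B n)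
    have hsq := Real.sq_sqrt hn
    have hstep : B n + (Real.sqrt (B n) + 1 / 4) ≤ B (n + 1) := by
      apply hB
      have : 0 ≤ x ^ 2 * B n * (Real.sqrt (B n) + 1 / 4 + B n) := by positivity
      nlinarith
    have : Real.sqrt (B n) + 1 / 2 ≤ Real.sqrt (B (n + 1)) :=
      Real.le_sqrt_of_sq_le (by nlinarith)
    push_cast
    linarith

theorem mul_le_succ (hB : GrowsByRoot x B) (hB0 : B 0 = 0) (hx : 0 ≤ x) (n : ℕ) :
    (1 + x + x ^ 2 / 2) * B n ≤ B (n + 1) := by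
  have hn := hB.nonneg hB0 n
  have := hB n ((x + x ^ 2 / 2) * B n) (by
    have h₁ : 0 ≤ x ^ 4 / 4 * B n ^ 2 := by positivity
    have h₂ : 0 ≤ (1 + x + x ^ 2 / 2) * B n := by positivity
    nlinarith)
  linarith

theorem pow_le (hB : GrowsByRoot x B) (hB0 : B 0 = 0) (hx : 0 ≤ x) (hx1 : x ≤ 1)
    {n : ℕ} (hn : 3 ≤ n) : (1 + x) ^ n ≤ B n := by
  induction n, hn using Nat.le_induction with
  | base =>
    have h₁ : 1 ≤ B 1 := by
      have := hB 0 1 (by simp [hB0])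
      simpa [hB0] using this
    have h₂ : 13 / 5 + x ^ 2 ≤ B 2 := by
      have := hB 1 (8 / 5 + x ^ 2) (by
        have : (1 + x ^ 2) * (8 / 5 + x ^ 2 + 1) ≤
            (1 + x ^ 2 * B 1) * (8 / 5 + x ^ 2 + B 1) := by
          gcongr
          nlinarith [sq_nonneg x]
        nlinarith [sq_nonneg x])
      norm_num at this
      linarith
    calc (1 + x) ^ 3 ≤ (1 + x + x ^ 2 / 2) * (13 / 5 + x ^ 2) := by
          nlinarith [mul_nonneg hx (sub_nonneg.2 hx1), sq_nonneg (x ^ 2)]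
      _ ≤ (1 + x + x ^ 2 / 2) * B 2 := by gcongr
      _ ≤ B 3 := hB.mul_le_succ hB0 hx 2
  | succ n _ ih =>
    calc (1 + x) ^ (n + 1) = (1 + x) * (1 + x) ^ n := pow_succ' _ _
      _ ≤ (1 + x + x ^ 2 / 2) * B n :=
          mul_le_mul (le_add_of_nonneg_right (by positivity)) ih (by positivity) (by positivity)
      _ ≤ B (n + 1) := hB.mul_le_succ hB0 hx n

end GrowsByRoot

theorem three_halves_lt_log_six : 3 / 2 < Real.log 6 := by
  rw [Real.lt_log_iff_exp_lt (by norm_num)]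
  have h := Real.exp_one_lt_d9
  have hsq : Real.exp (3 / 2) ^ 2 = Real.exp 1 ^ 3 := by
    rw [← Real.exp_nat_mul, ← Real.exp_nat_mul]
    norm_num
  have hcube : Real.exp 1 ^ 3 < 2.7182818286 ^ 3 := by gcongr
  refine lt_of_pow_lt_pow_left₀ 2 (by norm_num) ?_
  rw [hsq]
  exact hcube.trans (by norm_num)

/-- If `n` is at least `(1 / 2 + s) * log y`, then `y ≤ (1 + 1 / s) ^ n`. -/
theorem le_one_add_inv_pow {s y : ℝ} (hs : 0 < s) (hy : 0 < y) {n : ℕ}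
    (h : (1 / 2 + s) * Real.log y ≤ n) : y ≤ (1 + s⁻¹) ^ n := by
  rw [← Real.log_le_log_iff hy (by positivity), Real.log_pow]
  have hlog := Real.le_log_one_add_of_nonneg (inv_nonneg.2 hs.le)
  have hrate : 2 * s⁻¹ / (s⁻¹ + 2) = (1 / 2 + s)⁻¹ := by
    field_simp
  rw [hrate] at hlog
  calc Real.log y ≤ n * (1 / 2 + s)⁻¹ := by
        rw [← div_eq_mul_inv, le_div_iff₀ (by positivity)]
        linarith
    _ ≤ n * Real.log (1 + s⁻¹) := by gcongr


/-- Proposition 2.8 (iteration count): if j ≥ min{ 2√(6λL), (1/2 + √(λL)) ln(6λL) },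
then A_j ≥ 6λ, where μ = 1/λ and λ ≥ 1/L. -/
theorem Aj_ge_six_lambda (L lam : ℝ) (hL : 0 < L) (hlam : 1 / L ≤ lam)
    (μ : ℝ) (hμ : μ = 1 / lam)
    (τ a A : ℕ → ℝ)
    (hτ0 : τ 0 = 1 / L) (hA0 : A 0 = 0)
    (ha : ∀ j : ℕ, a j = (τ j + Real.sqrt ((τ j) ^ 2 + 4 * τ j * A j)) / 2)
    (hA : ∀ j : ℕ, A (j + 1) = A j + a j)
    (hτ : ∀ j : ℕ, τ (j + 1) = τ j + μ * a j / L) :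
    ∀ j : ℕ, 1 ≤ j →
      min (2 * Real.sqrt (6 * lam * L))
          ((1 / 2 + Real.sqrt (lam * L)) * Real.log (6 * lam * L)) ≤ (j : ℝ) →
      6 * lam ≤ A j := by
  have hlam0 : 0 < lam := (one_div_pos.2 hL).trans_le hlam
  have hκ : 1 ≤ lam * L := by rwa [div_le_iff₀ hL] at hlam
  set s := Real.sqrt (lam * L)
  have hs1 : 1 ≤ s := Real.one_le_sqrt.2 hκ
  have hs0 : 0 < s := one_pos.trans_le hs1
  have hsq : s ^ 2 = lam * L := Real.sq_sqrt (by positivity)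
  have hτA : ∀ n, L * τ n = 1 + s⁻¹ ^ 2 * (L * A n) := by
    intro n
    rw [inv_pow, hsq]
    induction n with
    | zero => rw [hτ0, hA0]; field_simp; ring
    | succ n ih =>
      rw [hτ, hA, mul_add, ih, hμ]
      field_simp
      ring
  have hB : GrowsByRoot s⁻¹ fun n => L * A n := by
    intro n c hc
    rw [← hτA] at hc
    have hroot : c / L ≤ a n := by
      rw [ha]
      apply le_larger_root
      rw [div_pow, div_le_iff₀ (by positivity)]
      calc c ^ 2 ≤ L * τ n * (c + L * A n) := hc
        _ = τ n * (c / L + A n) * L ^ 2 := by field_simp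
    rw [div_le_iff₀ hL] at hroot
    simp only [hA]
    linarith
  have hB0 : L * A 0 = 0 := by rw [hA0, mul_zero]
  intro j _ hmin
  suffices h : 6 * lam * L ≤ L * A j by
    refine le_of_mul_le_mul_left ?_ hL
    linarith
  rcases min_le_iff.1 hmin with h | h
  · have hj := hB.half_le_sqrt hB0 j
    exact (Real.sqrt_le_sqrt_iff (hB.nonneg hB0 j)).1 (by linarith)
  · have hlog : 3 / 2 < Real.log (6 * lam * L) :=
      three_halves_lt_log_six.trans_le (Real.log_le_log (by norm_num) (by linarith))
    have hj : 3 ≤ j := by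
      have : (2 : ℝ) < j := by nlinarith
      exact_mod_cast this
    exact (le_one_add_inv_pow hs0 (by positivity) h).trans
      (hB.pow_le hB0 (by positivity) (inv_le_one_of_one_le₀ hs1) hj)
end

section
/- For every u ∈ E, φ(u) ≥ φ(x̃) + ⟨(x_0 − x)/λ, u − x̃⟩ − ε (i.e., (x_0 − x)/λ is an ε-subgradient of φ at x̃), and ‖x − x̃‖² + 2λ ε = 2λ t; consequently, for any δ > 0, if t ≤ δ then ‖λ·((x_0 − x)/λ) + x̃ − x_0‖² + 2λ ε ≤ 2λ δ, so the triple (x̃, (x_0 − x)/λ, ε) satisfies the HPE acceptance criteria with prox center x_0. -/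
open scoped RealInnerProductSpace

/-- An affine function of the step length that is nonnegative on `(0, 1]` is nonnegative at `0`. -/
lemma nonneg_of_forall_add_mul_nonneg {a b : ℝ} (hb : 0 ≤ b)
    (H : ∀ s : ℝ, 0 < s → s ≤ 1 → 0 ≤ a + s * b) : 0 ≤ a := by
  by_contra! ha
  have hpos : 0 < b - a := by linarith
  have key := H (-a / (b - a)) (div_pos (by linarith) hpos)
    ((div_le_one hpos).2 (by linarith))
  have e : a + -a / (b - a) * b = -(a ^ 2 / (b - a)) := by
    field_simp
    ring
  have : 0 < a ^ 2 / (b - a) := div_pos (by nlinarith) hpos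
  linarith

/-- Optimality condition of the proximal subproblem: if `x` minimizes
`g + ‖· - x0‖² / (2 * lam)` then `(x0 - x) / lam` is a subgradient of `g` at `x`. -/
lemma ConvexOn.add_inner_le_of_prox_min
    {E : Type*} [NormedAddCommGroup E] [InnerProductSpace ℝ E]
    {lam : ℝ} (hlam : 0 < lam) {g : E → ℝ} (hg : ConvexOn ℝ Set.univ g) {x0 x : E}
    (hx : ∀ u : E, g x + 1 / (2 * lam) * ‖x - x0‖ ^ 2 ≤ g u + 1 / (2 * lam) * ‖u - x0‖ ^ 2)
    (u : E) : g x + lam⁻¹ * ⟪x0 - x, u - x⟫ ≤ g u := by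
  suffices 0 ≤ g u - g x - lam⁻¹ * ⟪x0 - x, u - x⟫ by linarith
  refine nonneg_of_forall_add_mul_nonneg (b := 1 / (2 * lam) * ‖u - x‖ ^ 2) (by positivity) ?_
  intro s hs hs1
  have hconv := hg.2 (Set.mem_univ x) (Set.mem_univ u) (sub_nonneg.2 hs1) hs.le (by ring)
  have hmin := hx ((1 - s) • x + s • u)
  have hnorm : ‖(1 - s) • x + s • u - x0‖ ^ 2
      = ‖x - x0‖ ^ 2 - 2 * s * ⟪x0 - x, u - x⟫ + s ^ 2 * ‖u - x‖ ^ 2 := by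
    have e : (1 - s) • x + s • u - x0 = s • (u - x) - (x0 - x) := by module
    rw [e, norm_sub_sq_real, norm_smul, real_inner_smul_left, mul_pow, Real.norm_eq_abs, sq_abs,
      norm_sub_rev x x0, real_inner_comm]
    ring
  rw [hnorm] at hmin
  simp only [smul_eq_mul] at hconv
  refine nonneg_of_mul_nonneg_right (a := s) ?_ hs
  have e : s * (g u - g x - lam⁻¹ * ⟪x0 - x, u - x⟫ + s * (1 / (2 * lam) * ‖u - x‖ ^ 2))
      = ((1 - s) * g x + s * g u + 1 / (2 * lam) *
          (‖x - x0‖ ^ 2 - 2 * s * ⟪x0 - x, u - x⟫ + s ^ 2 * ‖u - x‖ ^ 2))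
        - (g x + 1 / (2 * lam) * ‖x - x0‖ ^ 2) := by
    field_simp
    ring
  rw [e]
  linarith

/-- Lemma 3.1: (x_0 − x)/λ ∈ ∂_ε φ(x̃), ‖x − x̃‖² + 2λε = 2λt, and if t ≤ δ then the
triple (x̃, (x_0 − x)/λ, ε) satisfies the HPE acceptance criteria with prox center x_0. -/
theorem mpb_is_hpe
    {E : Type*} [NormedAddCommGroup E] [InnerProductSpace ℝ E] [FiniteDimensional ℝ E]
    (lam : ℝ) (hlam : 0 < lam)
    (f h : E → ℝ) (hf : ConvexOn ℝ Set.univ f) (hh : ConvexOn ℝ Set.univ h)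
    (x0 : E)
    (Γ : E → ℝ) (hΓ : ConvexOn ℝ Set.univ Γ) (hΓle : ∀ u : E, Γ u ≤ f u)
    (x : E)
    (hx : ∀ u : E, Γ x + h x + 1 / (2 * lam) * ‖x - x0‖ ^ 2
      ≤ Γ u + h u + 1 / (2 * lam) * ‖u - x0‖ ^ 2)
    (m : ℝ) (hm : m = Γ x + h x + 1 / (2 * lam) * ‖x - x0‖ ^ 2)
    (xt : E) (t ε : ℝ)
    (ht : t = (f xt + h xt + 1 / (2 * lam) * ‖xt - x0‖ ^ 2) - m)
    (hε : ε = (f xt + h xt) - (Γ x + h x) + lam⁻¹ * ⟪x0 - x, x - xt⟫) :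
    (∀ u : E, f u + h u ≥ f xt + h xt + ⟪lam⁻¹ • (x0 - x), u - xt⟫ - ε)
    ∧ ‖x - xt‖ ^ 2 + 2 * lam * ε = 2 * lam * t
    ∧ ∀ δ : ℝ, 0 < δ → t ≤ δ →
        ‖lam • (lam⁻¹ • (x0 - x)) + xt - x0‖ ^ 2 + 2 * lam * ε ≤ 2 * lam * δ := by
  have hid : ‖x - xt‖ ^ 2 + 2 * lam * ε = 2 * lam * t := by
    have hnorm : ‖xt - x0‖ ^ 2 = ‖x0 - x‖ ^ 2 + 2 * ⟪x0 - x, x - xt⟫ + ‖x - xt‖ ^ 2 := by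
      rw [← norm_add_sq_real, norm_sub_rev xt x0, sub_add_sub_cancel]
    rw [hε, ht, hm, hnorm, norm_sub_rev x x0]
    field_simp
    ring
  refine ⟨fun u => ?_, hid, fun δ _ htδ => ?_⟩
  · have hsub := (hΓ.add hh).add_inner_le_of_prox_min hlam hx u
    simp only [Pi.add_apply] at hsub
    have hsplit : ⟪x0 - x, u - xt⟫ = ⟪x0 - x, u - x⟫ + ⟪x0 - x, x - xt⟫ := by
      rw [← inner_add_right, sub_add_sub_cancel]
    rw [real_inner_smul_left, hsplit, hε]
    linarith [hΓle u]
  · have e : lam • (lam⁻¹ • (x0 - x)) + xt - x0 = xt - x := by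
      rw [smul_inv_smul₀ hlam.ne']
      abel
    rw [e, norm_sub_rev, hid]
    gcongr
end
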